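/- The elements a₂ a₃ ⋯ aₙ of H(e,e,n), indexed by tuples (a₂, …, aₙ) where aᵢ ranges over the i·e listed expressions of Λᵢ, are pairwise distinct and form an R₀-basis of H(e,e,n): they are R₀-linearly independent and they span H(e,e,n) as an R₀-module. (There are e^{n−1}·n! such elements.) -/

import Mathlib

noncomputable section

open scoped Pointwise

/-- The base ring `R₀ = ℤ[a]`. -/
abbrev R0 : Type := Polynomial ℤ

/-- The variable `a ∈ R₀`. -/
def aP : R0 := Polynomial.X

/-- Generators of the Corran–Picantin presentation: `t_i` for `i ∈ ℤ/eℤ` and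
`s_j` for `3 ≤ j ≤ n`. -/
inductive HGen (e n : ℕ) : Type
  | t : ZMod e → HGen e n
  | s : (j : ℕ) → 3 ≤ j → j ≤ n → HGen e n

open FreeAlgebra

/-- The free `R₀`-algebra on the generators. -/
abbrev FA (e n : ℕ) : Type := FreeAlgebra R0 (HGen e n)

/-- The defining relations of the Hecke algebra `H(e,e,n)`. -/
inductive HRel (e n : ℕ) : FA e n → FA e n → Prop
  | tt (i j : ZMod e) :
      HRel e n (ι R0 (HGen.t i) * ι R0 (HGen.t (i - 1)))
               (ι R0 (HGen.t j) * ι R0 (HGen.t (j - 1)))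
  | tst (i : ZMod e) (h : 3 ≤ n) :
      HRel e n (ι R0 (HGen.t i) * ι R0 (HGen.s 3 le_rfl h) * ι R0 (HGen.t i))
               (ι R0 (HGen.s 3 le_rfl h) * ι R0 (HGen.t i) * ι R0 (HGen.s 3 le_rfl h))
  | st (i : ZMod e) (j : ℕ) (h3 : 3 ≤ j) (h4 : 4 ≤ j) (hn : j ≤ n) :
      HRel e n (ι R0 (HGen.s j h3 hn) * ι R0 (HGen.t i))
               (ι R0 (HGen.t i) * ι R0 (HGen.s j h3 hn))
  | braid (i : ℕ) (h3 : 3 ≤ i) (h3' : 3 ≤ i + 1) (hn' : i ≤ n) (hn : i + 1 ≤ n) :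
      HRel e n (ι R0 (HGen.s i h3 hn') * ι R0 (HGen.s (i + 1) h3' hn) * ι R0 (HGen.s i h3 hn'))
               (ι R0 (HGen.s (i + 1) h3' hn) * ι R0 (HGen.s i h3 hn') * ι R0 (HGen.s (i + 1) h3' hn))
  | comm (i j : ℕ) (h3i : 3 ≤ i) (hni : i ≤ n) (h3j : 3 ≤ j) (hnj : j ≤ n)
      (hij : i + 1 < j ∨ j + 1 < i) :
      HRel e n (ι R0 (HGen.s i h3i hni) * ι R0 (HGen.s j h3j hnj))
               (ι R0 (HGen.s j h3j hnj) * ι R0 (HGen.s i h3i hni))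
  | tq (i : ZMod e) :
      HRel e n (ι R0 (HGen.t i) * ι R0 (HGen.t i))
               (algebraMap R0 (FA e n) aP * ι R0 (HGen.t i) + 1)
  | sq (j : ℕ) (h3 : 3 ≤ j) (hn : j ≤ n) :
      HRel e n (ι R0 (HGen.s j h3 hn) * ι R0 (HGen.s j h3 hn))
               (algebraMap R0 (FA e n) aP * ι R0 (HGen.s j h3 hn) + 1)

/-- The Hecke algebra `H(e,e,n)`. -/
abbrev Hecke (e n : ℕ) : Type := RingQuot (HRel e n)

/-- The generator `t_i` of `H(e,e,n)`. -/
def tH (e n : ℕ) (i : ZMod e) : Hecke e n :=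
  RingQuot.mkAlgHom R0 (HRel e n) (ι R0 (HGen.t i))

/-- The generator `s_j` of `H(e,e,n)` (junk value `1` when `j` is out of range). -/
def sH (e n : ℕ) (j : ℕ) : Hecke e n :=
  if h : 3 ≤ j ∧ j ≤ n then RingQuot.mkAlgHom R0 (HRel e n) (ι R0 (HGen.s j h.1 h.2)) else 1

/-- Decreasing-index product `s_m s_{m-1} ⋯ s_{i'}` (empty when `m < i'`). -/
def sDescH (e n m i' : ℕ) : Hecke e n :=
  (((List.range' i' (m + 1 - i')).reverse).map (sH e n)).prod

/-- Increasing-index product `s_{i'} s_{i'+1} ⋯ s_m` (empty when `m < i'`). -/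
def sAscH (e n i' m : ℕ) : Hecke e n :=
  ((List.range' i' (m + 1 - i')).map (sH e n)).prod

/-- `Λ₂ = {1} ∪ {t_k : 0 ≤ k ≤ e-1} ∪ {t_k t₀ : 1 ≤ k ≤ e-1}` in `H(e,e,n)`. -/
def Lam2 (e n : ℕ) : Set (Hecke e n) :=
  {1} ∪ {x | ∃ k < e, x = tH e n (k : ZMod e)} ∪
    {x | ∃ k, 1 ≤ k ∧ k < e ∧ x = tH e n (k : ZMod e) * tH e n 0}

/-- `Λ_m = {1} ∪ {s_m ⋯ s_{i'} : 3 ≤ i' ≤ m} ∪ {s_m ⋯ s₃ t_k : 0 ≤ k ≤ e-1}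
∪ {s_m ⋯ s₃ t_k s₂ s₃ ⋯ s_{i'} : 1 ≤ k ≤ e-1, 2 ≤ i' ≤ m}` in `H(e,e,n)`,
where `s₂ = t₀`. -/
def LamH (e n m : ℕ) : Set (Hecke e n) :=
  {1} ∪ {x | ∃ i', 3 ≤ i' ∧ i' ≤ m ∧ x = sDescH e n m i'} ∪
    {x | ∃ k < e, x = sDescH e n m 3 * tH e n (k : ZMod e)} ∪
    {x | ∃ k, 1 ≤ k ∧ k < e ∧ ∃ i', 2 ≤ i' ∧ i' ≤ m ∧
      x = sDescH e n m 3 * tH e n (k : ZMod e) * tH e n 0 * sAscH e n 3 i'}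


/-- Index type enumerating the `m·e` listed expressions of `Λ_m` for `2 ≤ m ≤ n`. -/
inductive LamIdx (e m : ℕ) : Type
  | one : LamIdx e m
  | sdesc (i' : ℕ) (h3 : 3 ≤ i') (hi : i' ≤ m) : LamIdx e m
  | st (k : ℕ) (hk : k < e) : LamIdx e m
  | stst (k : ℕ) (hk1 : 1 ≤ k) (hk : k < e) (i' : ℕ) (h2 : 2 ≤ i') (hi : i' ≤ m) : LamIdx e m

/-- Evaluation of a listed expression of `Λ_m` in `H(e,e,n)`. -/
def lamEvalH (e n m : ℕ) : LamIdx e m → Hecke e n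
  | .one => 1
  | .sdesc i' _ _ => sDescH e n m i'
  | .st k _ => sDescH e n m 3 * tH e n (k : ZMod e)
  | .stst k _ _ i' _ _ => sDescH e n m 3 * tH e n (k : ZMod e) * tH e n 0 * sAscH e n 3 i'

/-- The element `a₂ a₃ ⋯ aₙ` of `H(e,e,n)` indexed by a tuple of listed expressions. -/
def nfH (e n : ℕ) (p : ∀ j : Fin (n - 1), LamIdx e (j.val + 2)) : Hecke e n :=
  ((List.finRange (n - 1)).map (fun j : Fin (n - 1) => lamEvalH e n (j.val + 2) (p j))).prod

set_option linter.unusedSectionVars false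

section Generic

variable {A : Type*} [Ring A] [Algebra R0 A]

/-- Generic decreasing product. -/
def gDesc (s : ℕ → A) (m i' : ℕ) : A := (((List.range' i' (m + 1 - i')).reverse).map s).prod

/-- Generic increasing product. -/
def gAsc (s : ℕ → A) (i' m : ℕ) : A := ((List.range' i' (m + 1 - i')).map s).prod

/-- Generic evaluation of a listed expression. -/
def gLam {e : ℕ} (t : ZMod e → A) (s : ℕ → A) (m : ℕ) : LamIdx e m → A
  | .one => 1
  | .sdesc i' _ _ => gDesc s m i'
  | .st k _ => gDesc s m 3 * t (k : ZMod e)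
  | .stst k _ _ i' _ _ => gDesc s m 3 * t (k : ZMod e) * t 0 * gAsc s 3 i'

/-- Generic evaluation of a tuple. -/
def gNf {e : ℕ} (t : ZMod e → A) (s : ℕ → A) (N : ℕ) (p : ∀ j : Fin N, LamIdx e (j.val + 2)) : A :=
  ((List.finRange N).map (fun j : Fin N => gLam t s (j.val + 2) (p j))).prod

theorem gDesc_empty (s : ℕ → A) {m i : ℕ} (h : m < i) : gDesc s m i = 1 := by
  simp [gDesc, show m + 1 - i = 0 by omega]

theorem gAsc_empty (s : ℕ → A) {m i : ℕ} (h : m < i) : gAsc s i m = 1 := by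
  simp [gAsc, show m + 1 - i = 0 by omega]

theorem gDesc_top (s : ℕ → A) {m i : ℕ} (h : i ≤ m + 1) :
    gDesc s (m + 1) i = s (m + 1) * gDesc s m i := by
  rw [gDesc, show m + 1 + 1 - i = (m + 1 - i) + 1 by omega, List.range'_concat]
  simp [gDesc, show i + (m + 1 - i) = m + 1 by omega]

theorem gAsc_top (s : ℕ → A) {m i : ℕ} (h : i ≤ m + 1) :
    gAsc s i (m + 1) = gAsc s i m * s (m + 1) := by
  rw [gAsc, show m + 1 + 1 - i = (m + 1 - i) + 1 by omega, List.range'_concat]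
  simp [gAsc, show i + (m + 1 - i) = m + 1 by omega]

theorem gDesc_bot (s : ℕ → A) {m i : ℕ} (h : i ≤ m) :
    gDesc s m i = gDesc s m (i + 1) * s i := by
  rw [gDesc, show m + 1 - i = (m - i) + 1 by omega, List.range'_succ]
  simp [gDesc, show m + 1 - (i + 1) = m - i by omega]

theorem gAsc_bot (s : ℕ → A) {m i : ℕ} (h : i ≤ m) :
    gAsc s i m = s i * gAsc s (i + 1) m := by
  rw [gAsc, show m + 1 - i = (m - i) + 1 by omega, List.range'_succ]
  simp [gAsc, show m + 1 - (i + 1) = m - i by omega]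

theorem gAsc_comm (s : ℕ → A) {x : A} {m i : ℕ} (h : ∀ j, i ≤ j → j ≤ m → x * s j = s j * x) :
    x * gAsc s i m = gAsc s i m * x := by
  apply Commute.list_prod_right
  intro y hy
  simp only [List.mem_map, List.mem_range'_1] at hy
  obtain ⟨j, hj, rfl⟩ := hy
  exact h j hj.1 (by omega)

theorem gDesc_comm (s : ℕ → A) {x : A} {m i : ℕ} (h : ∀ j, i ≤ j → j ≤ m → x * s j = s j * x) :
    x * gDesc s m i = gDesc s m i * x := by
  apply Commute.list_prod_right
  intro y hy
  simp only [List.mem_map, List.mem_reverse, List.mem_range'_1] at hy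
  obtain ⟨j, hj, rfl⟩ := hy
  exact h j hj.1 (by omega)

theorem gNf_succ {e : ℕ} (t : ZMod e → A) (s : ℕ → A) (N : ℕ)
    (p : ∀ j : Fin (N + 1), LamIdx e (j.val + 2)) :
    gNf t s (N + 1) p = gNf t s N (fun j => p j.castSucc) * gLam t s (N + 2) (p (Fin.last N)) := by
  simp [gNf, List.finRange_succ_last, Function.comp_def]

/-- Any relation compatible with products propagates to normal forms. -/
theorem gNf_rel {A' : Type*} [Ring A'] [Algebra R0 A'] {e : ℕ} (r : A → A' → Prop)
    (r1 : r 1 1) (rm : ∀ x x' y y', r x x' → r y y' → r (x * y) (x' * y'))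
    (t : ZMod e → A) (t' : ZMod e → A') (s : ℕ → A) (s' : ℕ → A') (N : ℕ)
    (ht : ∀ k, r (t k) (t' k)) (hs : ∀ j, 3 ≤ j → j ≤ N + 1 → r (s j) (s' j))
    (p : ∀ j : Fin N, LamIdx e (j.val + 2)) : r (gNf t s N p) (gNf t' s' N p) := by
  have hl : ∀ {ι : Type} (l : List ι) (f : ι → A) (f' : ι → A'), (∀ i ∈ l, r (f i) (f' i)) →
      r (l.map f).prod (l.map f').prod := by
    intro ι l f f' h
    induction l with
    | nil => simpa using r1
    | cons i l ih =>
      simp only [List.map_cons, List.prod_cons]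
      exact rm _ _ _ _ (h i (by simp)) (ih fun j hj => h j (by simp [hj]))
  apply hl
  intro j _
  have hj := j.2
  have hd : ∀ m i, 3 ≤ i → m ≤ N + 1 → r (gDesc s m i) (gDesc s' m i) := by
    intro m i h3 hm
    apply hl
    intro l hl
    simp only [List.mem_reverse, List.mem_range'_1] at hl
    exact hs _ (by omega) (by omega)
  have ha : ∀ m i, 3 ≤ i → m ≤ N + 1 → r (gAsc s i m) (gAsc s' i m) := by
    intro m i h3 hm
    apply hl
    intro l hl
    simp only [List.mem_range'_1] at hl
    exact hs _ (by omega) (by omega)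
  cases p j with
  | one => exact r1
  | sdesc i' h3 hi => exact hd _ _ h3 (by omega)
  | st k hk => exact rm _ _ _ _ (hd _ _ le_rfl (by omega)) (ht _)
  | stst k h1 hk i' h2 hi =>
    exact rm _ _ _ _ (rm _ _ _ _ (rm _ _ _ _ (hd _ _ le_rfl (by omega)) (ht _)) (ht _))
      (ha _ _ le_rfl (by omega))

/-- Type A Hecke relations for `s_lo, …, s_n`. -/
structure Br (lo n : ℕ) (s : ℕ → A) : Prop where
  sq : ∀ j, lo ≤ j → j ≤ n → s j * s j = algebraMap R0 A aP * s j + 1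
  br : ∀ i, lo ≤ i → i + 1 ≤ n → s i * s (i + 1) * s i = s (i + 1) * s i * s (i + 1)
  cm : ∀ i j, lo ≤ i → i + 1 < j → j ≤ n → s i * s j = s j * s i

theorem Br.desc {lo n : ℕ} {s : ℕ → A} (h : Br lo n s) {m i j : ℕ} (h1 : 1 ≤ i) (hi : lo ≤ i) (hij : i < j)
    (hjm : j ≤ m) (hm : m ≤ n) : gDesc s m i * s j = s (j - 1) * gDesc s m i := by
  induction m with
  | zero => omega
  | succ m ih =>
    rw [gDesc_top s (by omega)]
    rcases Nat.lt_or_ge j (m + 1) with hj | hj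
    · rw [mul_assoc, ih (by omega) (by omega), ← mul_assoc, ← mul_assoc,
        h.cm (j - 1) (m + 1) (by omega) (by omega) hm]
    · obtain rfl : j = m + 1 := by omega
      obtain ⟨l, rfl⟩ : ∃ l, m = l + 1 := ⟨m - 1, by omega⟩
      have hc := gDesc_comm s (x := s (l + 1 + 1)) (m := l) (i := i)
        (fun j h1 h2 => (h.cm j (l + 1 + 1) (by omega) (by omega) hm).symm)
      have hb := h.br (l + 1) (by omega) hm
      rw [gDesc_top s (by omega), Nat.add_sub_cancel]
      calc s (l + 1 + 1) * (s (l + 1) * gDesc s l i) * s (l + 1 + 1)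
          = s (l + 1 + 1) * s (l + 1) * (gDesc s l i * s (l + 1 + 1)) := by noncomm_ring
        _ = s (l + 1 + 1) * s (l + 1) * s (l + 1 + 1) * gDesc s l i := by rw [← hc]; noncomm_ring
        _ = _ := by rw [← hb]; noncomm_ring

theorem Br.asc {lo n : ℕ} {s : ℕ → A} (h : Br lo n s) {m i j : ℕ} (h1 : 1 ≤ i) (hi : lo ≤ i) (hij : i ≤ j)
    (hjm : j < m) (hm : m ≤ n) : gAsc s i m * s j = s (j + 1) * gAsc s i m := by
  induction m with
  | zero => omega
  | succ m ih =>
    rw [gAsc_top s (by omega)]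
    rcases Nat.lt_or_ge j m with hj | hj
    · rw [mul_assoc, ← h.cm j (m + 1) (by omega) (by omega) hm, ← mul_assoc,
        ih (by omega) (by omega), ← mul_assoc]
    · obtain rfl : j = m := by omega
      obtain ⟨l, rfl⟩ : ∃ l, j = l + 1 := ⟨j - 1, by omega⟩
      · have hc := gAsc_comm s (x := s (l + 1 + 1)) (m := l) (i := i)
          (fun j h1 h2 => (h.cm j (l + 1 + 1) (by omega) (by omega) hm).symm)
        have hb := h.br (l + 1) (by omega) hm
        rw [gAsc_top s (by omega)]
        calc gAsc s i l * s (l + 1) * s (l + 1 + 1) * s (l + 1)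
            = gAsc s i l * (s (l + 1) * s (l + 1 + 1) * s (l + 1)) := by noncomm_ring
          _ = gAsc s i l * s (l + 1 + 1) * s (l + 1) * s (l + 1 + 1) := by
              rw [hb]; noncomm_ring
          _ = _ := by rw [← hc]; noncomm_ring

end Generic

section AKSec

variable {A : Type*} [Ring A] [Algebra R0 A]

/-- Relations of the Ariki–Koike algebra with `τ ^ e = 1`. -/
structure AK (e n : ℕ) (τ : A) (s : ℕ → A) : Prop where
  toBr : Br 2 n s
  pow : τ ^ e = 1
  cmt : ∀ j, 3 ≤ j → j ≤ n → s j * τ = τ * s j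
  b4 : 2 ≤ n → s 2 * τ * s 2 * τ = τ * s 2 * τ * s 2

/-- Powers of `τ` indexed by `ℤ/e`. -/
def pw {e : ℕ} (τ : A) (k : ZMod e) : A := τ ^ k.val

theorem pw_natCast {e : ℕ} {τ : A} (h : τ ^ e = 1) (m : ℕ) : pw τ (m : ZMod e) = τ ^ m := by
  rw [pw, ZMod.val_natCast]
  conv_rhs => rw [← Nat.div_add_mod m e, pow_add, pow_mul, h, one_pow, one_mul]

theorem pw_add {e : ℕ} [NeZero e] {τ : A} (h : τ ^ e = 1) (k l : ZMod e) :
    pw τ (k + l) = pw τ k * pw τ l := by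
  obtain ⟨a, rfl⟩ := ZMod.natCast_zmod_surjective k
  obtain ⟨b, rfl⟩ := ZMod.natCast_zmod_surjective l
  rw [← Nat.cast_add, pw_natCast h, pw_natCast h, pw_natCast h, pow_add]

theorem pw_zero {e : ℕ} {τ : A} (h : τ ^ e = 1) : pw τ (0 : ZMod e) = 1 := by
  simpa using pw_natCast h 0

theorem pw_one {e : ℕ} {τ : A} (h : τ ^ e = 1) : pw τ (1 : ZMod e) = τ := by
  simpa using pw_natCast h 1

theorem pw_neg {e : ℕ} [NeZero e] {τ : A} (h : τ ^ e = 1) (k : ZMod e) :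
    pw τ (-k) * pw τ k = 1 := by rw [← pw_add h, neg_add_cancel, pw_zero h]

theorem pw_neg' {e : ℕ} [NeZero e] {τ : A} (h : τ ^ e = 1) (k : ZMod e) :
    pw τ k * pw τ (-k) = 1 := by rw [← pw_add h, add_neg_cancel, pw_zero h]

/-- Key commutation formula. -/
theorem key_pow {s τ α : A} (hα : ∀ x, α * x = x * α) (hs : s * s = α * s + 1)
    (hb : s * τ * s * τ = τ * s * τ * s) (k : ℕ) :
    s * τ ^ k * s * τ = τ * s * τ ^ k * s + α * (τ ^ k * s * τ - τ * s * τ ^ k) := by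
  have hJ : ∀ k : ℕ, s * τ * s * τ ^ k = τ ^ k * (s * τ * s) := by
    intro k
    have : Commute (s * τ * s) τ := by
      rw [Commute, SemiconjBy, hb]; noncomm_ring
    exact (this.pow_right k).eq
  induction k with
  | zero =>
    simp only [pow_zero, mul_one, one_mul, hs, mul_assoc]
    rw [hα s, hα (s * τ - τ * s)]
    simp only [mul_add, add_mul, mul_sub, sub_mul, mul_assoc, hα τ, hα s]
    noncomm_ring
  | succ k ih =>
    -- `s τ^{k+1} s = s τ^k (s - α) J`
    have hsi : (s - α) * s = 1 := by rw [sub_mul, hs]; noncomm_ring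
    have hJ1 := hJ 1
    simp only [pow_one] at hJ1
    have e1 : ∀ x : A, x * τ ^ (k + 1) * s = x * τ ^ k * (s - α) * (s * τ * s) := by
      intro x
      calc x * τ ^ (k + 1) * s = x * τ ^ k * 1 * τ * s := by rw [pow_succ]; noncomm_ring
        _ = _ := by rw [← hsi]; noncomm_ring
    have e2 : τ ^ k * s * τ * (s * τ * s) = α * (τ ^ k * s * τ * s * τ) + τ ^ (k + 1) * s * τ := by
      calc τ ^ k * s * τ * (s * τ * s) = τ ^ k * s * (τ * (s * τ * s)) := by noncomm_ring
        _ = τ ^ k * (s * s) * τ * s * τ := by rw [← hJ1]; noncomm_ring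
        _ = τ ^ k * α * s * τ * s * τ + τ ^ k * τ * s * τ := by rw [hs]; noncomm_ring
        _ = _ := by rw [← hα, pow_succ]; noncomm_ring
    have e3 : s * τ ^ (k + 1) * (s * τ * s)
        = α * (τ ^ k * s * τ * s * τ) + τ * s * τ ^ (k + 1) := by
      calc s * τ ^ (k + 1) * (s * τ * s) = s * (τ ^ (k + 1) * (s * τ * s)) := by noncomm_ring
        _ = s * s * τ * s * τ ^ (k + 1) := by rw [← hJ]; noncomm_ring
        _ = α * (s * τ * s * τ ^ k * τ) + τ * s * τ ^ (k + 1) := by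
            rw [hs, pow_succ]; noncomm_ring
        _ = _ := by rw [hJ]; noncomm_ring
    calc s * τ ^ (k + 1) * s * τ = s * τ ^ k * (s - α) * ((s * τ * s) * τ) := by
          rw [e1]; noncomm_ring
      _ = s * τ ^ k * s * τ * (s * τ * s) - s * τ ^ k * α * τ * (s * τ * s) := by
          rw [hJ1]; noncomm_ring
      _ = (τ * s * τ ^ k * s + α * (τ ^ k * s * τ - τ * s * τ ^ k)) * (s * τ * s)
            - α * (s * τ ^ (k + 1) * (s * τ * s)) := by
          rw [ih, ← hα, pow_succ]; noncomm_ring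
      _ = τ * s * τ ^ k * s * (s * τ * s) - α * (τ * s * τ ^ k) * (s * τ * s)
          + α * (τ ^ k * s * τ * (s * τ * s) - s * τ ^ (k + 1) * (s * τ * s)) := by noncomm_ring
      _ = τ * s * τ ^ k * s * (s * τ * s) - (τ * s * τ ^ k) * α * (s * τ * s)
          + α * (τ ^ (k + 1) * s * τ - τ * s * τ ^ (k + 1)) := by
          rw [e2, e3, hα (τ * s * τ ^ k)]; noncomm_ring
      _ = _ := by rw [e1 (τ * s)]; noncomm_ring

/-- Relations of `H(e,e,n)` in a generic algebra. -/
structure HK (e n : ℕ) (t : ZMod e → A) (s : ℕ → A) : Prop where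
  toBr : Br 3 n s
  tt : ∀ i j, t i * t (i - 1) = t j * t (j - 1)
  tst : 3 ≤ n → ∀ i, t i * s 3 * t i = s 3 * t i * s 3
  st : ∀ i j, 4 ≤ j → j ≤ n → s j * t i = t i * s j
  tq : ∀ i, t i * t i = algebraMap R0 A aP * t i + 1

/-- The elements `t_k = τ^{-k} s₂ τ^k`. -/
def akT {e : ℕ} (τ : A) (s : ℕ → A) (k : ZMod e) : A := pw τ (-k) * s 2 * pw τ k

theorem AK.pwcm {e n : ℕ} {τ : A} {s : ℕ → A} (h : AK e n τ s) (j : ℕ) (h3 : 3 ≤ j)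
    (hj : j ≤ n) (k : ZMod e) : s j * pw τ k = pw τ k * s j :=
  (Commute.pow_right (h.cmt j h3 hj) _).eq

theorem AK.hk {e n : ℕ} [NeZero e] (hn : 2 ≤ n) {τ : A} {s : ℕ → A} (h : AK e n τ s) :
    HK e n (akT (e := e) τ s) s where
  toBr := ⟨fun j h3 => h.toBr.sq j (by omega), fun j h3 => h.toBr.br j (by omega),
    fun i j h3 => h.toBr.cm i j (by omega)⟩
  tt := by
    have : ∀ i : ZMod e, akT τ s i * akT τ s (i - 1) = s 2 * τ * s 2 * pw τ (-1 : ZMod e) := by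
      intro i
      have hJ : Commute (s 2 * τ * s 2) τ := by
        rw [Commute, SemiconjBy, h.b4 hn]; noncomm_ring
      have hJ' : s 2 * τ * s 2 * pw τ (-i) = pw τ (-i) * (s 2 * τ * s 2) := (hJ.pow_right _).eq
      calc akT τ s i * akT τ s (i - 1)
          = pw τ (-i) * s 2 * (pw τ i * pw τ (-(i - 1))) * s 2 * pw τ (i - 1) := by
            rw [akT, akT]; noncomm_ring
        _ = (pw τ (-i) * (s 2 * τ * s 2)) * pw τ (i - 1) := by
            rw [← pw_add h.pow, show i + -(i - 1) = 1 by ring, pw_one h.pow]; noncomm_ring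
        _ = (s 2 * τ * s 2) * (pw τ (-i) * pw τ (i - 1)) := by rw [← hJ', mul_assoc]
        _ = _ := by rw [← pw_add h.pow, show -i + (i - 1) = -1 by ring]
    intro i j; rw [this, this]
  tst := by
    intro h3 i
    have c1 := h.pwcm 3 le_rfl h3 i
    have c2 := h.pwcm 3 le_rfl h3 (-i)
    have b := h.toBr.br 2 le_rfl h3
    simp only [akT]
    calc pw τ (-i) * s 2 * pw τ i * s 3 * (pw τ (-i) * s 2 * pw τ i)
        = pw τ (-i) * s 2 * (pw τ i * s 3) * pw τ (-i) * s 2 * pw τ i := by noncomm_ring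
      _ = pw τ (-i) * s 2 * s 3 * (pw τ i * pw τ (-i)) * s 2 * pw τ i := by
          rw [← c1]; noncomm_ring
      _ = pw τ (-i) * (s 2 * s 3 * s 2) * pw τ i := by rw [pw_neg' h.pow]; noncomm_ring
      _ = (pw τ (-i) * s 3) * s 2 * (s 3 * pw τ i) := by rw [b]; noncomm_ring
      _ = _ := by rw [← c2, c1]; noncomm_ring
  st := by
    intro i j h4 hj
    have c1 := h.pwcm j (by omega) hj i
    have c2 := h.pwcm j (by omega) hj (-i)
    have b := h.toBr.cm 2 j le_rfl (by omega) hj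
    simp only [akT]
    calc s j * (pw τ (-i) * s 2 * pw τ i) = (s j * pw τ (-i)) * s 2 * pw τ i := by noncomm_ring
      _ = pw τ (-i) * (s j * s 2) * pw τ i := by rw [c2]; noncomm_ring
      _ = pw τ (-i) * s 2 * (s j * pw τ i) := by rw [← b]; noncomm_ring
      _ = _ := by rw [c1]; noncomm_ring
  tq := by
    intro i
    have hα := Algebra.commutes (A := A) aP
    simp only [akT]
    calc pw τ (-i) * s 2 * pw τ i * (pw τ (-i) * s 2 * pw τ i)
        = pw τ (-i) * s 2 * (pw τ i * pw τ (-i)) * s 2 * pw τ i := by noncomm_ring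
      _ = pw τ (-i) * (s 2 * s 2) * pw τ i := by rw [pw_neg' h.pow]; noncomm_ring
      _ = pw τ (-i) * algebraMap R0 A aP * s 2 * pw τ i + pw τ (-i) * pw τ i := by
          rw [h.toBr.sq 2 le_rfl hn]; noncomm_ring
      _ = _ := by rw [← hα, pw_neg h.pow]; noncomm_ring

end AKSec

section Ind

variable {B : Type} [Ring B] [Algebra R0 B]

/-- The induced left module with basis `v i k`. -/
abbrev NM (B : Type) [Ring B] (e n : ℕ) : Type := ({i : ℕ // 1 ≤ i ∧ i ≤ n} × ZMod e) →₀ B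

/-- Basis vectors (zero when out of range). -/
def vv (B : Type) [Ring B] (e n : ℕ) (i : ℕ) (k : ZMod e) : NM B e n :=
  if h : 1 ≤ i ∧ i ≤ n then Finsupp.single (⟨i, h⟩, k) 1 else 0

/-- The linear map with prescribed values on the basis. -/
def opOf {e n : ℕ} (f : ℕ → ZMod e → NM B e n) : Module.End B (NM B e n) :=
  Finsupp.linearCombination B (fun x : {i : ℕ // 1 ≤ i ∧ i ≤ n} × ZMod e => f x.1.1 x.2)

theorem opOf_vv {e n : ℕ} (f : ℕ → ZMod e → NM B e n) {i : ℕ} (h1 : 1 ≤ i) (h2 : i ≤ n)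
    (k : ZMod e) : opOf f (vv B e n i k) = f i k := by
  simp [opOf, vv, h1, h2]

theorem end_ext {e n : ℕ} {f g : Module.End B (NM B e n)}
    (h : ∀ i k, 1 ≤ i → i ≤ n → f (vv B e n i k) = g (vv B e n i k)) : f = g := by
  apply Finsupp.lhom_ext'
  rintro ⟨⟨i, h1, h2⟩, k⟩
  apply LinearMap.ext_ring
  simpa [vv, h1, h2] using h i k h1 h2

/-- Action of `s_j` on the basis. -/
def fS (e n : ℕ) (s : ℕ → B) (j i : ℕ) (k : ZMod e) : NM B e n :=
  if j < i then s j • vv B e n i k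
  else if j = i then (if k = 0 then vv B e n (i - 1) k
    else algebraMap R0 B aP • vv B e n i k + vv B e n (i - 1) k)
  else if j = i + 1 then (if k = 0 then algebraMap R0 B aP • vv B e n i k + vv B e n (i + 1) k
    else vv B e n (i + 1) k)
  else s (j - 1) • vv B e n i k

/-- Action of `τ` on the basis. -/
def fT (e n : ℕ) (τ : B) (s : ℕ → B) (i : ℕ) (k : ZMod e) : NM B e n :=
  if i = 1 then vv B e n 1 (k + 1)
  else if k = 0 then τ • vv B e n i k
  else τ • vv B e n i k + algebraMap R0 B aP •
    ((pw τ k * gAsc s 2 (i - 1)) • vv B e n 1 1 - (τ * gAsc s 2 (i - 1)) • vv B e n 1 k)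

/-- The operator `s_j`. -/
def oS (e n : ℕ) (s : ℕ → B) (j : ℕ) : Module.End B (NM B e n) := opOf (fS e n s j)

/-- The operator `τ`. -/
def oT (e n : ℕ) (τ : B) (s : ℕ → B) : Module.End B (NM B e n) := opOf (fT e n τ s)

variable {e n : ℕ} {τ : B} {s : ℕ → B}

theorem oS_lt {j i : ℕ} (k : ZMod e) (h2 : i ≤ n) (h : j < i) :
    oS e n s j (vv B e n i k) = s j • vv B e n i k := by
  rw [oS, opOf_vv _ (by omega) h2]; simp [fS, h]

theorem oS_gt {j i : ℕ} (k : ZMod e) (h1 : 1 ≤ i) (h2 : i ≤ n) (h : i + 1 < j) :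
    oS e n s j (vv B e n i k) = s (j - 1) • vv B e n i k := by
  rw [oS, opOf_vv _ (by omega) h2, fS, if_neg (by omega), if_neg (by omega), if_neg (by omega)]

theorem oS_dn0 {i : ℕ} (h2 : i + 1 ≤ n) :
    oS e n s (i + 1) (vv B e n (i + 1) 0) = vv B e n i 0 := by
  rw [oS, opOf_vv _ (by omega) h2]; simp [fS]

theorem oS_dn {i : ℕ} {k : ZMod e} (hk : k ≠ 0) (h2 : i + 1 ≤ n) :
    oS e n s (i + 1) (vv B e n (i + 1) k)
      = algebraMap R0 B aP • vv B e n (i + 1) k + vv B e n i k := by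
  rw [oS, opOf_vv _ (by omega) h2]; simp [fS, hk]

theorem oS_up0 {i : ℕ} (h1 : 1 ≤ i) (h2 : i ≤ n) :
    oS e n s (i + 1) (vv B e n i 0) = algebraMap R0 B aP • vv B e n i 0 + vv B e n (i + 1) 0 := by
  rw [oS, opOf_vv _ h1 h2]; simp [fS]

theorem oS_up {i : ℕ} {k : ZMod e} (hk : k ≠ 0) (h1 : 1 ≤ i) (h2 : i ≤ n) :
    oS e n s (i + 1) (vv B e n i k) = vv B e n (i + 1) k := by
  rw [oS, opOf_vv _ h1 h2]; simp [fS, hk]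

theorem oT_one (hn : 1 ≤ n) (k : ZMod e) : oT e n τ s (vv B e n 1 k) = vv B e n 1 (k + 1) := by
  rw [oT, opOf_vv _ le_rfl hn]; simp [fT]

theorem oT_zero {i : ℕ} (h1 : 2 ≤ i) (h2 : i ≤ n) :
    oT e n τ s (vv B e n i 0) = τ • vv B e n i 0 := by
  rw [oT, opOf_vv _ (by omega) h2, fT, if_neg (by omega), if_pos rfl]

theorem oT_ne {i : ℕ} {k : ZMod e} (hk : k ≠ 0) (h1 : 1 ≤ i) (h2 : i + 1 ≤ n) :
    oT e n τ s (vv B e n (i + 1) k) = τ • vv B e n (i + 1) k + algebraMap R0 B aP •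
    ((pw τ k * gAsc s 2 i) • vv B e n 1 1 - (τ * gAsc s 2 i) • vv B e n 1 k) := by
  rw [oT, opOf_vv _ (by omega) h2, fT, if_neg (by omega), if_neg hk, Nat.add_sub_cancel]

theorem oS_sq {m : ℕ} (h : Br 2 m s) {j : ℕ} (h2 : 2 ≤ j) (hj : j ≤ m + 1)
    (v : NM B e (m + 1)) :
    oS e (m + 1) s j (oS e (m + 1) s j v) = algebraMap R0 B aP • oS e (m + 1) s j v + v := by
  have hα := Algebra.commutes (A := B) aP
  suffices H : oS e (m + 1) s j * oS e (m + 1) s j = aP • oS e (m + 1) s j + 1 by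
    simpa [algebraMap_smul] using LinearMap.congr_fun H v
  apply end_ext
  intro i k h1 hi
  simp only [Module.End.mul_apply, LinearMap.add_apply, LinearMap.smul_apply, Module.End.one_apply]
  simp only [← algebraMap_smul B aP]
  rcases lt_trichotomy j i with hc | rfl | hc
  · simp only [oS_lt k hi hc, map_smul, smul_smul, h.sq j h2 (by omega), add_smul, one_smul]
  · obtain ⟨i, rfl⟩ : ∃ i, j = i + 1 := ⟨j - 1, by omega⟩
    by_cases hk : k = 0
    · subst hk
      rw [oS_dn0 hi, oS_up0 (by omega) (by omega)]
    · rw [oS_dn hk hi, map_add, map_smul, oS_up hk (by omega) (by omega), oS_dn hk hi]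
  · rcases Nat.lt_or_ge (i + 1) j with hc' | hc'
    · simp only [oS_gt k h1 hi hc', map_smul, smul_smul, h.sq (j - 1) (by omega) (by omega),
        add_smul, one_smul]
    · obtain rfl : j = i + 1 := by omega
      by_cases hk : k = 0
      · subst hk
        rw [oS_up0 h1 hi, map_add, map_smul, oS_dn0 hj, oS_up0 h1 hi]
      · rw [oS_up hk h1 hi, oS_dn hk hj]

theorem oS_cm {m : ℕ} (h : Br 2 m s) {j l : ℕ} (h2 : 2 ≤ j) (hjl : j + 1 < l) (hl : l ≤ m + 1)
    (v : NM B e (m + 1)) :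
    oS e (m + 1) s l (oS e (m + 1) s j v) = oS e (m + 1) s j (oS e (m + 1) s l v) := by
  suffices H : oS e (m + 1) s l * oS e (m + 1) s j = oS e (m + 1) s j * oS e (m + 1) s l from
    LinearMap.congr_fun H v
  apply end_ext
  intro i k h1 hi
  simp only [Module.End.mul_apply]
  -- positions of `j`, `l` relative to `i`
  rcases Nat.lt_or_ge l i with c | c
  · simp only [oS_lt k hi c, oS_lt k hi (show j < i by omega), map_smul, smul_smul,
      h.cm j l h2 hjl (by omega)]
  rcases Nat.lt_or_ge (i + 1) j with c' | c'
  · simp only [oS_gt k h1 hi c', oS_gt k h1 hi (show i + 1 < l by omega), map_smul, smul_smul,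
      h.cm (j - 1) (l - 1) (by omega) (by omega) (by omega)]
  rcases Nat.lt_or_ge j i with d | d
  · -- j < i ≤ l
    rcases Nat.lt_or_ge (i + 1) l with d' | d'
    · simp only [oS_lt k hi d, oS_gt k h1 hi d', map_smul, smul_smul,
        h.cm j (l - 1) h2 (by omega) (by omega)]
    · rcases Nat.eq_or_lt_of_le c with rfl | c2
      · obtain ⟨i, rfl⟩ : ∃ i', i = i' + 1 := ⟨i - 1, by omega⟩
        by_cases hk : k = 0
        · subst hk
          rw [oS_lt 0 hi d, map_smul, oS_dn0 hi, oS_lt 0 (by omega) (by omega)]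
        · rw [oS_lt k hi d, map_smul, oS_dn hk hi, map_add, map_smul, oS_lt k hi d,
            oS_lt k (by omega) (by omega), smul_add, smul_smul, smul_smul, Algebra.commutes]
      · obtain rfl : l = i + 1 := by omega
        by_cases hk : k = 0
        · subst hk
          rw [oS_lt 0 hi d, map_smul, oS_up0 h1 hi, map_add, map_smul, oS_lt 0 hi d,
            oS_lt 0 (by omega) (by omega), smul_add, smul_smul, smul_smul, Algebra.commutes]
        · rw [oS_lt k hi d, map_smul, oS_up hk h1 hi, oS_lt k (by omega) (by omega)]
  · -- i ≤ j ≤ i + 1 < l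
    have d' : i + 1 < l := by omega
    rcases Nat.eq_or_lt_of_le d with rfl | c2
    · obtain ⟨i, rfl⟩ : ∃ i', i = i' + 1 := ⟨i - 1, by omega⟩
      by_cases hk : k = 0
      · subst hk
        rw [oS_gt 0 h1 hi d', map_smul, oS_dn0 hi, oS_gt 0 (by omega) (by omega) (by omega)]
      · rw [oS_gt k h1 hi d', map_smul, oS_dn hk hi, map_add, map_smul, oS_gt k h1 hi d',
          oS_gt k (by omega) (by omega) (by omega), smul_add, smul_smul, smul_smul,
          Algebra.commutes]
    · obtain rfl : j = i + 1 := by omega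
      by_cases hk : k = 0
      · subst hk
        rw [oS_gt 0 h1 hi d', map_smul, oS_up0 h1 hi, map_add, map_smul, oS_gt 0 h1 hi d',
          oS_gt 0 (by omega) (by omega) (by omega), smul_add, smul_smul, smul_smul,
          Algebra.commutes]
      · rw [oS_gt k h1 hi d', map_smul, oS_up hk h1 hi, oS_gt k (by omega) (by omega) (by omega)]

theorem oS_br {m : ℕ} (h : Br 2 m s) {j : ℕ} (h2 : 2 ≤ j) (hj : j + 1 ≤ m + 1)
    (v : NM B e (m + 1)) :
    oS e (m + 1) s j (oS e (m + 1) s (j + 1) (oS e (m + 1) s j v))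
      = oS e (m + 1) s (j + 1) (oS e (m + 1) s j (oS e (m + 1) s (j + 1) v)) := by
  suffices H : oS e (m + 1) s j * (oS e (m + 1) s (j + 1) * oS e (m + 1) s j)
      = oS e (m + 1) s (j + 1) * (oS e (m + 1) s j * oS e (m + 1) s (j + 1)) from
    LinearMap.congr_fun H v
  apply end_ext
  intro i k h1 hi
  simp only [Module.End.mul_apply]
  rcases Nat.lt_or_ge (j + 1) i with c | c
  · simp only [oS_lt k hi c, oS_lt k hi (show j < i by omega), map_smul, smul_smul,
      h.br j h2 (by omega)]
  rcases Nat.lt_or_ge (i + 1) j with c' | c'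
  · have := h.br (j - 1) (by omega) (by omega)
    rw [show j - 1 + 1 = j by omega] at this
    simp only [oS_gt k h1 hi c', oS_gt k h1 hi (show i + 1 < j + 1 by omega), map_smul, smul_smul,
      Nat.add_sub_cancel, this]
  have hα := Algebra.commutes (A := B) aP
  have hcases : i = j + 1 ∨ i = j ∨ i + 1 = j := by omega
  rcases hcases with rfl | rfl | rfl
  · obtain ⟨i, rfl⟩ : ∃ i, j = i + 1 := ⟨j - 1, by omega⟩
    have a1 := fun k : ZMod e => oS_lt (n := m + 1) (s := s) (j := i + 1) (i := i + 1 + 1) k hi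
      (by omega)
    have a2 := fun k : ZMod e => oS_gt (n := m + 1) (s := s) (j := i + 1 + 1) (i := i) k
      (by omega) (by omega) (by omega)
    rw [Nat.add_sub_cancel] at a2
    by_cases hk : k = 0
    · subst hk
      simp only [a1, a2, map_smul, oS_dn0 hi, oS_dn0 (show i + 1 ≤ m + 1 by omega)]
    · simp only [a1, a2, map_smul, map_add, oS_dn hk hi, oS_dn hk (show i + 1 ≤ m + 1 by omega),
        oS_up hk (show 1 ≤ i + 1 by omega) (show i + 1 ≤ m + 1 by omega),
        smul_add, smul_smul, hα]
      have e1 : s (i + 1) * algebraMap R0 B aP * s (i + 1) = s (i + 1) * algebraMap R0 B aP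
          * algebraMap R0 B aP + algebraMap R0 B aP := by
        rw [← hα, mul_assoc, h.sq (i + 1) (by omega) (by omega), mul_add, mul_one, hα, hα]
      rw [e1, add_smul]; abel
  · obtain ⟨i, rfl⟩ : ∃ i', i = i' + 1 := ⟨i - 1, by omega⟩
    have a1 := fun k : ZMod e => oS_lt (n := m + 1) (s := s) (j := i + 1) (i := i + 1 + 1) k hj
      (by omega)
    have a2 := fun k : ZMod e => oS_gt (n := m + 1) (s := s) (j := i + 1 + 1) (i := i) k
      (by omega) (by omega) (by omega)
    rw [Nat.add_sub_cancel] at a2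
    by_cases hk : k = 0
    · subst hk
      simp only [a1, a2, map_smul, map_add, oS_dn0 hi, oS_dn0 hj, oS_up0 h1 hi, oS_up0 (show 1 ≤ i by omega)
        (show i ≤ m + 1 by omega), smul_add, smul_smul, hα]
    · simp only [a1, a2, map_smul, map_add, oS_dn hk hi, oS_up hk h1 hi,
        oS_up hk (show 1 ≤ i by omega) (show i ≤ m + 1 by omega), oS_dn hk hj,
        smul_add, smul_smul, hα]
  · have a1 := fun k : ZMod e => oS_lt (n := m + 1) (s := s) (j := i + 1) (i := i + 1 + 1) k hj
      (by omega)
    have a2 := fun k : ZMod e => oS_gt (n := m + 1) (s := s) (j := i + 1 + 1) (i := i) k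
      (by omega) (by omega) (by omega)
    rw [Nat.add_sub_cancel] at a2
    have hi2 : i + 1 ≤ m + 1 := by omega
    by_cases hk : k = 0
    · subst hk
      simp only [a1, a2, map_smul, map_add, oS_up0 h1 hi, oS_up0 (show 1 ≤ i + 1 by omega) hi2,
        oS_dn0 hi2, smul_add, smul_smul, hα]
      have e1 : s (i + 1) * algebraMap R0 B aP * s (i + 1) = s (i + 1) * algebraMap R0 B aP
          * algebraMap R0 B aP + algebraMap R0 B aP := by
        rw [← hα, mul_assoc, h.sq (i + 1) (by omega) (by omega), mul_add, mul_one, hα, hα]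
      rw [e1, add_smul]; abel
    · simp only [a1, a2, map_smul, map_add, oS_up hk h1 hi, oS_up hk (show 1 ≤ i + 1 by omega) hi2,
        smul_add, smul_smul, hα]

end Ind

section IndT

variable {B : Type} [Ring B] [Algebra R0 B] {e : ℕ} {τ : B} {s : ℕ → B}

theorem oT_pow_one {n : ℕ} (hn : 1 ≤ n) (k : ZMod e) (r : ℕ) :
    (oT e n τ s ^ r) (vv B e n 1 k) = vv B e n 1 (k + r) := by
  induction r with
  | zero => simp
  | succ r ih => rw [pow_succ', Module.End.mul_apply, ih, oT_one hn]; push_cast; rw [add_assoc]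

theorem oT_pow_zero {n : ℕ} {i : ℕ} (h1 : 2 ≤ i) (h2 : i ≤ n) (r : ℕ) :
    (oT e n τ s ^ r) (vv B e n i 0) = τ ^ r • vv B e n i 0 := by
  induction r with
  | zero => simp
  | succ r ih => rw [pow_succ', Module.End.mul_apply, ih, map_smul, oT_zero h1 h2, smul_smul,
      pow_succ]

theorem oT_pow {n : ℕ} [NeZero e] (hτ : τ ^ e = 1) : oT e n τ s ^ e = 1 := by
  have hα := Algebra.commutes (A := B) aP
  apply end_ext
  intro i k h1 hi
  rw [Module.End.one_apply]
  rcases Nat.eq_or_lt_of_le h1 with rfl | h1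
  · rw [oT_pow_one hi]; simp
  by_cases hk : k = 0
  · subst hk
    rw [oT_pow_zero h1 hi, hτ, one_smul]
  obtain ⟨i, rfl⟩ : ∃ i', i = i' + 1 := ⟨i - 1, by omega⟩
  have key : ∀ r : ℕ, (oT e n τ s ^ r) (vv B e n (i + 1) k) = τ ^ r • vv B e n (i + 1) k +
      algebraMap R0 B aP • ∑ j ∈ Finset.range r,
        ((pw τ ((j : ZMod e) + k) * gAsc s 2 i) • vv B e n 1 ((r : ZMod e) - j)
        - (pw τ ((j : ZMod e) + 1) * gAsc s 2 i) • vv B e n 1 (k + ((r : ZMod e) - 1 - j))) := by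
    intro r
    induction r with
    | zero => simp
    | succ r ih =>
      rw [pow_succ', Module.End.mul_apply, ih, map_add, map_smul, map_smul, map_sum,
        oT_ne hk (by omega) hi, Finset.sum_range_succ, smul_add, smul_smul, ← pow_succ, smul_smul,
        ← hα, ← smul_smul, add_assoc, ← smul_add]
      congr 2
      rw [add_comm]
      congr 1
      · apply Finset.sum_congr rfl
        intro j _
        rw [map_sub, map_smul, map_smul, oT_one (by omega), oT_one (by omega)]
        congr 3 <;> push_cast <;> ring
      · rw [smul_sub, smul_smul, smul_smul, pw_add hτ, pw_natCast hτ, pw_add hτ, pw_one hτ,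
          pw_natCast hτ, mul_assoc, mul_assoc]
        congr 3 <;> push_cast <;> ring
  rw [key, hτ, one_smul]
  have hz : ∑ j ∈ Finset.range e,
        ((pw τ ((j : ZMod e) + k) * gAsc s 2 i) • vv B e n 1 ((e : ZMod e) - j)
        - (pw τ ((j : ZMod e) + 1) * gAsc s 2 i) • vv B e n 1 (k + ((e : ZMod e) - 1 - j))) = 0 := by
    have hsum : ∀ F : ZMod e → NM B e n, ∑ j ∈ Finset.range e, F (j : ZMod e) = ∑ x, F x := by
      intro F
      refine Finset.sum_bij' (fun j _ => (j : ZMod e)) (fun x _ => x.val) ?_ ?_ ?_ ?_ ?_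
      · simp
      · intro x _; simpa using ZMod.val_lt x
      · intro j hj; simpa using ZMod.val_cast_of_lt (Finset.mem_range.1 hj)
      · intro x _; simp
      · simp
    rw [hsum (fun x => (pw τ (x + k) * gAsc s 2 i) • vv B e n 1 ((e : ZMod e) - x)
        - (pw τ (x + 1) * gAsc s 2 i) • vv B e n 1 (k + ((e : ZMod e) - 1 - x))),
      Finset.sum_sub_distrib, sub_eq_zero]
    refine Fintype.sum_equiv (Equiv.addRight (k - 1)) _ _ ?_
    intro x
    simp only [Equiv.coe_addRight]
    congr 3 <;> ring_nf
  rw [hz, smul_zero, add_zero]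

theorem aux_comm {x y z : B} (h : y * x = x * y) :
    algebraMap R0 B aP * (x * (y * z)) = y * (algebraMap R0 B aP * (x * z)) := by
  rw [← mul_assoc x, ← h, mul_assoc y, ← mul_assoc, Algebra.commutes, mul_assoc]

theorem oT_cm {m : ℕ} (h : AK e m τ s) {j : ℕ} (h3 : 3 ≤ j) (hj : j ≤ m + 1)
    (v : NM B e (m + 1)) :
    oT e (m + 1) τ s (oS e (m + 1) s j v) = oS e (m + 1) s j (oT e (m + 1) τ s v) := by
  suffices H : oT e (m + 1) τ s * oS e (m + 1) s j = oS e (m + 1) s j * oT e (m + 1) τ s from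
    LinearMap.congr_fun H v
  have hα := Algebra.commutes (A := B) aP
  apply end_ext
  intro i k h1 hi
  simp only [Module.End.mul_apply]
  have a1 := fun k : ZMod e => oS_gt (n := m + 1) (s := s) (j := j) (i := 1) k
      le_rfl (by omega) (by omega)
  have a2 := fun k : ZMod e => oT_one (n := m + 1) (s := s) (τ := τ) (by omega) k
  rcases Nat.eq_or_lt_of_le h1 with rfl | h1
  · simp only [a1, a2, map_smul]
  obtain ⟨i, rfl⟩ : ∃ i', i = i' + 1 := ⟨i - 1, by omega⟩
  have b0 := oT_zero (e := e) (n := m + 1) (s := s) (τ := τ) h1 hi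
  have b1 := fun k : ZMod e => fun hk => oT_ne (n := m + 1) (s := s) (τ := τ) (k := k) hk
    (i := i) (by omega) hi
  rcases Nat.lt_or_ge j (i + 1) with c | c
  · have c1 := h.cmt j h3 (by omega)
    by_cases hk : k = 0
    · subst hk
      simp only [oS_lt 0 hi c, b0, map_smul, smul_smul, c1]
    · have c2 := h.toBr.asc (m := i) (i := 2) (j := j - 1) (by omega) (by omega) (by omega)
        (by omega) (by omega)
      rw [show j - 1 + 1 = j by omega] at c2
      simp only [oS_lt k hi c, b1 k hk, map_smul, map_add, map_sub, a1, smul_add, smul_sub,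
        smul_smul, mul_assoc, c2, c1]
      congr 3
      · exact (aux_comm (h.pwcm j h3 (by omega) k)).symm
      · exact (aux_comm c1).symm
  rcases Nat.lt_or_ge (i + 1 + 1) j with d | d
  · have c1 := h.cmt (j - 1) (by omega) (by omega)
    by_cases hk : k = 0
    · subst hk
      simp only [oS_gt 0 (by omega) hi d, b0, map_smul, smul_smul, c1]
    · have c2 := gAsc_comm s (x := s (j - 1)) (m := i) (i := 2)
        (fun l h1 h2 => (h.toBr.cm l (j - 1) (by omega) (by omega) (by omega)).symm)
      simp only [oS_gt k (by omega) hi d, b1 k hk, map_smul, map_add, map_sub, a1, smul_add,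
        smul_sub, smul_smul, mul_assoc, ← c2, c1]
      congr 3
      · exact (aux_comm (h.pwcm (j - 1) (by omega) (by omega) k)).symm
      · exact (aux_comm c1).symm
  rcases Nat.eq_or_lt_of_le c with rfl | c
  · -- j = i + 1
    by_cases hk : k = 0
    · subst hk
      rw [oS_dn0 hi, b0, map_smul, oS_dn0 hi, oT_zero (by omega) (by omega)]
    · obtain ⟨i, rfl⟩ : ∃ i', i = i' + 1 := ⟨i - 1, by omega⟩
      have c2 : gAsc s 2 (i + 1) * s (i + 1)
          = algebraMap R0 B aP * gAsc s 2 (i + 1) + gAsc s 2 i := by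
        rw [gAsc_top s (by omega), mul_assoc, h.toBr.sq _ (by omega) (by omega), mul_add,
          ← mul_assoc, ← hα, mul_one, mul_assoc]
      simp only [oS_dn hk hi, b1 k hk, map_smul, map_add, map_sub, a1, Nat.add_sub_cancel,
        oT_ne hk (show 1 ≤ i by omega) (show i + 1 ≤ m + 1 by omega), smul_add, smul_sub,
        smul_smul, mul_assoc, c2, mul_add, add_smul]
      simp only [← mul_assoc, hα]
      abel
  · obtain rfl : j = i + 1 + 1 := by omega
    by_cases hk : k = 0
    · subst hk
      rw [oS_up0 (by omega) hi, b0, map_smul, oS_up0 (by omega) hi, map_add, map_smul, b0,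
        oT_zero (by omega) (by omega), smul_add, smul_smul, smul_smul, hα]
    · simp only [oS_up hk (show 1 ≤ i + 1 by omega) hi, b1 k hk, map_smul, map_add, map_sub, a1,
        Nat.add_sub_cancel, oT_ne hk (show 1 ≤ i + 1 by omega) hj,
        gAsc_top s (show 2 ≤ i + 1 by omega), smul_smul, mul_assoc]

end IndT

section IndB

variable {B : Type} [Ring B] [Algebra R0 B] {e : ℕ} {τ : B} {s : ℕ → B}

theorem oT_b4 {m : ℕ} [NeZero e] (hm : 1 ≤ m) (h : AK e m τ s) (v : NM B e (m + 1)) :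
    oT e (m + 1) τ s (oS e (m + 1) s 2 (oT e (m + 1) τ s (oS e (m + 1) s 2 v)))
     = oS e (m + 1) s 2 (oT e (m + 1) τ s (oS e (m + 1) s 2 (oT e (m + 1) τ s v))) := by
  have hα := Algebra.commutes (A := B) aP
  have hτ := h.pow
  by_cases he : (1 : ZMod e) = 0
  · -- `e = 1`: `τ` acts as the identity
    have h0 : ∀ k : ZMod e, k = 0 := fun k => by rw [← mul_one k, he, mul_zero]
    have hτ1 : τ = 1 := by rw [← pw_one hτ, he, pw_zero hτ]
    have hid : oT e (m + 1) τ s = 1 := by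
      apply end_ext
      intro i k h1 hi
      rw [Module.End.one_apply, h0 k]
      rcases Nat.eq_or_lt_of_le h1 with rfl | h1
      · rw [oT_one hi, h0 (0 + 1)]
      · rw [oT_zero h1 hi, hτ1, one_smul]
    simp [hid]
  suffices H : oT e (m + 1) τ s * (oS e (m + 1) s 2 * (oT e (m + 1) τ s * oS e (m + 1) s 2))
     = oS e (m + 1) s 2 * (oT e (m + 1) τ s * (oS e (m + 1) s 2 * oT e (m + 1) τ s)) from
    LinearMap.congr_fun H v
  -- formulas on small positions
  have t1 := fun k : ZMod e => oT_one (n := m + 1) (s := s) (τ := τ) (by omega) k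
  have t20 := oT_zero (e := e) (n := m + 1) (s := s) (τ := τ) (i := 2) le_rfl (by omega)
  have t2 : ∀ k : ZMod e, k ≠ 0 → oT e (m + 1) τ s (vv B e (m + 1) 2 k) =
      τ • vv B e (m + 1) 2 k + algebraMap R0 B aP •
        (pw τ k • vv B e (m + 1) 1 1 - τ • vv B e (m + 1) 1 k) := by
    intro k hk
    have := oT_ne (n := m + 1) (s := s) (τ := τ) hk (i := 1) le_rfl (by omega)
    simpa [gAsc_empty s (show 1 < 2 by omega)] using this
  have s10 := oS_up0 (e := e) (n := m + 1) (s := s) (i := 1) le_rfl (by omega)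
  have s1 := fun (k : ZMod e) (hk : k ≠ 0) => oS_up (n := m + 1) (s := s) (i := 1) hk
    le_rfl (by omega)
  have s20 := oS_dn0 (e := e) (n := m + 1) (s := s) (i := 1) (by omega)
  have s2 := fun (k : ZMod e) (hk : k ≠ 0) => oS_dn (n := m + 1) (s := s) (i := 1) hk (by omega)
  simp only [Nat.reduceAdd] at s10 s1 s20 s2
  have t21 : oT e (m + 1) τ s (vv B e (m + 1) 2 1) = τ • vv B e (m + 1) 2 1 := by
    rw [t2 1 he, pw_one hτ, sub_self, smul_zero, add_zero]
  have ts2 : ∀ k : ZMod e, k ≠ 0 → oS e (m + 1) s 2 (oT e (m + 1) τ s (vv B e (m + 1) 2 k)) =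
      τ • vv B e (m + 1) 1 k + (algebraMap R0 B aP * pw τ k) • vv B e (m + 1) 2 1 := by
    intro k hk
    rw [t2 k hk]
    simp only [map_add, map_smul, map_sub, s2 k hk, s1 k hk, s1 1 he, smul_add, smul_sub,
      smul_smul, hα]
    abel
  apply end_ext
  intro i k h1 hi
  simp only [Module.End.mul_apply]
  rcases Nat.eq_or_lt_of_le h1 with rfl | h1
  · -- i = 1
    by_cases hk : k = 0
    · subst hk
      simp only [t1, s10, zero_add, s1 1 he, map_add, map_smul, t21, t20, s20, s2 1 he,
        smul_add, smul_smul, hα]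
    · by_cases hk1 : k + 1 = 0
      · have hp : pw τ k * τ = 1 := by
          rw [← pw_zero (e := e) hτ, ← hk1, pw_add hτ, pw_one hτ]
        simp only [t1, s1 k hk, ts2 k hk, hk1, s10, map_add, map_smul, t20, s20, t21, smul_smul,
          zero_add, s1 1 he, mul_assoc, hp, mul_one, add_comm]
      · simp only [t1, s1 k hk, s1 _ hk1, ts2 k hk, ts2 _ hk1, map_add, map_smul, t21, smul_smul,
          pw_add hτ, pw_one hτ, mul_assoc]
  rcases Nat.eq_or_lt_of_le (show 2 ≤ i from h1) with rfl | h2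
  · -- i = 2
    by_cases hk : k = 0
    · subst hk
      simp only [s20, t20, t1, zero_add, s1 1 he, map_smul, t21]
    · simp only [ts2 k hk, s2 k hk, map_add, map_smul, ts2 1 he, t1]
      by_cases hk1 : k + 1 = 0
      · have hp : pw τ k * τ = 1 := by
          rw [← pw_zero (e := e) hτ, ← hk1, pw_add hτ, pw_one hτ]
        simp only [hk1, s10, map_add, map_smul, t20, t21, t1, zero_add, smul_add, smul_smul,
          pw_one hτ, mul_assoc, hp, mul_one]
        simp only [← hα, mul_assoc, hp, mul_one]
        have hz : pw τ k * (algebraMap R0 B aP * τ) = algebraMap R0 B aP := by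
          rw [hα τ, ← mul_assoc, hp, one_mul]
        rw [hz]
        abel
      · simp only [s1 _ hk1, t2 _ hk1, map_add, map_smul, t21, smul_add, smul_sub, smul_smul,
          pw_add hτ, pw_one hτ, mul_assoc]
        have hz : pw τ k * (algebraMap R0 B aP * τ) = algebraMap R0 B aP * (pw τ k * τ) := by
          rw [← mul_assoc, ← hα, mul_assoc]
        rw [hz]
        abel
  · -- i ≥ 3
    have b := h.b4 (by omega)
    obtain ⟨i, rfl⟩ : ∃ i', i = i' + 1 := ⟨i - 1, by omega⟩
    have sl := fun k : ZMod e => oS_lt (n := m + 1) (s := s) (j := 2) k hi h2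
    by_cases hk : k = 0
    · subst hk
      simp only [sl, oT_zero h1 hi, map_smul, smul_smul, b]
    · have ti := oT_ne (n := m + 1) (s := s) (τ := τ) hk (i := i) (by omega) hi
      have hu : gAsc s 2 i = s 2 * gAsc s 3 i := gAsc_bot s (by omega)
      have hr : gAsc s 3 i * τ = τ * gAsc s 3 i :=
        (gAsc_comm s fun j h1 h2 => (h.cmt j h1 (by omega)).symm).symm
      have hrk : gAsc s 3 i * pw τ k = pw τ k * gAsc s 3 i :=
        (gAsc_comm s fun j h1 h2 => (h.pwcm j h1 (by omega) k).symm).symm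
      have hq := h.toBr.sq 2 le_rfl (by omega)
      have kp := key_pow hα hq b k.val
      change s 2 * pw τ k * s 2 * τ = τ * s 2 * pw τ k * s 2 +
        algebraMap R0 B aP * (pw τ k * s 2 * τ - τ * s 2 * pw τ k) at kp
      simp only [sl, ti, map_smul, map_add, map_sub, s1 1 he, s1 k hk, s2 1 he, ts2 k hk, s2 k hk, t21, t2 k hk, t1]
      generalize gAsc s 3 i = r at *
      generalize gAsc s 2 i = u at *
      subst hu
      have hJ1 : s 2 * τ * s 2 * τ = τ * (s 2 * τ * s 2) := by rw [b]; noncomm_ring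
      have hJk : s 2 * τ * s 2 * pw τ k = pw τ k * (s 2 * τ * s 2) :=
        (Commute.pow_right (show Commute (s 2 * τ * s 2) τ from hJ1) _).eq
      have hrc : ∀ x, algebraMap R0 B aP * x = aP • x := fun x => (Algebra.smul_def aP x).symm
      generalize pw τ k = p at *
      have g : ∀ q : B, r * q = q * r → s 2 * τ * s 2 * q = q * (s 2 * τ * s 2) →
          s 2 * (τ * (s 2 * (q * (s 2 * r)))) =
            q * (s 2 * (r * τ)) + aP • (s 2 * (τ * (s 2 * (r * q)))) := by
        intro q h1 h2
        rw [h1, hr, ← hrc]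
        calc s 2 * (τ * (s 2 * (q * (s 2 * r)))) = s 2 * τ * s 2 * q * s 2 * r := by noncomm_ring
          _ = q * s 2 * τ * (s 2 * s 2) * r := by rw [h2]; noncomm_ring
          _ = q * (s 2 * (τ * r)) + q * s 2 * τ * algebraMap R0 B aP * s 2 * r := by
            rw [hq]; noncomm_ring
          _ = q * (s 2 * (τ * r)) + algebraMap R0 B aP * (q * (s 2 * τ * s 2)) * r := by
            rw [← hα (q * s 2 * τ)]; noncomm_ring
          _ = _ := by rw [← h2]; noncomm_ring
      have f1 : s 2 * (p * (s 2 * (r * τ))) = τ * (s 2 * (p * (s 2 * r)))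
          + aP • (p * (s 2 * (r * τ))) - aP • (τ * (s 2 * (r * p))) := by
        rw [hr, hrk, ← hrc, ← hrc]
        calc s 2 * (p * (s 2 * (τ * r))) = s 2 * p * s 2 * τ * r := by noncomm_ring
          _ = _ := by rw [kp]; noncomm_ring
      have f2 : s 2 * (τ * (s 2 * (r * τ))) = τ * (s 2 * (τ * (s 2 * r))) := by
        rw [hr]
        calc s 2 * (τ * (s 2 * (τ * r))) = s 2 * τ * s 2 * τ * r := by noncomm_ring
          _ = _ := by rw [b]; noncomm_ring
      have f3 := g p hrk hJk
      have f4 := g τ hr hJ1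
      have b' : s 2 * (τ * (s 2 * τ)) = τ * (s 2 * (τ * s 2)) := by
        simpa only [mul_assoc] using b
      simp only [smul_add, smul_sub, smul_smul, Algebra.algebraMap_eq_smul_one, smul_mul_assoc,
        mul_smul_comm, one_mul, mul_one, mul_assoc, b']
      rw [f3, f4, f1, f2]
      simp only [smul_add, smul_sub, add_smul, sub_smul, smul_assoc, mul_smul aP aP]
      abel

end IndB

section Tower

variable {B : Type} [Ring B] [Algebra R0 B] {e : ℕ} {τ : B} {s : ℕ → B}

/-- The algebra of right operators. -/
abbrev OpA (B : Type) [Ring B] [Algebra R0 B] (e n : ℕ) : Type := (Module.End B (NM B e n))ᵐᵒᵖ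

theorem opA_ext {n : ℕ} {x y : OpA B e n} (h : ∀ v, x.unop v = y.unop v) : x = y :=
  MulOpposite.unop_injective (LinearMap.ext h)

theorem opA_mul {n : ℕ} (x y : OpA B e n) (v : NM B e n) : (x * y).unop v = y.unop (x.unop v) := rfl

theorem ak_succ {m : ℕ} [NeZero e] (hm : 1 ≤ m) (h : AK e m τ s) :
    AK e (m + 1) (MulOpposite.op (oT e (m + 1) τ s) : OpA B e (m + 1))
      (fun j => MulOpposite.op (oS e (m + 1) s j)) where
  toBr := by
    refine ⟨?_, ?_, ?_⟩
    · intro j h2 hj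
      apply opA_ext
      intro v
      rw [← Algebra.smul_def]
      simpa [opA_mul, algebraMap_smul] using oS_sq h.toBr h2 hj v
    · intro j h2 hj
      apply opA_ext
      intro v
      simpa [opA_mul] using oS_br h.toBr h2 hj v
    · intro i j h2 hij hj
      apply opA_ext
      intro v
      simpa [opA_mul] using oS_cm h.toBr h2 hij hj v
  pow := by
    rw [← MulOpposite.op_pow, oT_pow h.pow, MulOpposite.op_one]
  cmt := by
    intro j h3 hj
    apply opA_ext
    intro v
    simpa [opA_mul] using oT_cm h h3 hj v
  b4 := by
    intro _
    apply opA_ext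
    intro v
    simpa [opA_mul] using oT_b4 hm h v

/-- Row relation. -/
def rowR (B : Type) [Ring B] [Algebra R0 B] (e n : ℕ) (x' : OpA B e n) (x : B) : Prop :=
  x'.unop (vv B e n n 0) = x • vv B e n n 0

theorem rowR_one {n : ℕ} : rowR B e n 1 1 := by simp [rowR]

theorem rowR_mul {n : ℕ} (x' : OpA B e n) (x : B) (y' : OpA B e n) (y : B)
    (h1 : rowR B e n x' x) (h2 : rowR B e n y' y) : rowR B e n (x' * y') (x * y) := by
  rw [rowR] at *
  rw [opA_mul, h1, map_smul, h2, smul_smul]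

theorem rowR_pow {n : ℕ} (x' : OpA B e n) (x : B) (h1 : rowR B e n x' x) (r : ℕ) :
    rowR B e n (x' ^ r) (x ^ r) := by
  induction r with
  | zero => simpa using rowR_one
  | succ r ih => rw [pow_succ, pow_succ]; exact rowR_mul _ _ _ _ ih h1

/-- Position of the image of the last vector under a listed expression. -/
def posI (e m : ℕ) : LamIdx e m → ℕ
  | .one => m
  | .sdesc i' _ _ => i' - 1
  | .st _ _ => 1
  | .stst _ _ _ i' _ _ => i'

/-- Exponent of the image of the last vector under a listed expression. -/
def posK (e m : ℕ) : LamIdx e m → ℕ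
  | .one => 0
  | .sdesc _ _ _ => 0
  | .st k _ => k
  | .stst k _ _ _ _ _ => k

theorem posI_mem {e m : ℕ} (hm : 2 ≤ m) (l : LamIdx e m) : 1 ≤ posI e m l ∧ posI e m l ≤ m := by
  cases l <;> simp only [posI] <;> omega

theorem pos_inj {e m : ℕ} [NeZero e] (hm : 2 ≤ m) (l l' : LamIdx e m)
    (hI : posI e m l = posI e m l') (hK : (posK e m l : ZMod e) = (posK e m l' : ZMod e)) : l = l' := by
  have hlt : ∀ l : LamIdx e m, posK e m l < e := by
    intro l
    have := NeZero.pos e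
    cases l <;> simp only [posK] <;> omega
  have hK' : posK e m l = posK e m l' := by
    have := congrArg ZMod.val hK
    rwa [ZMod.val_natCast, ZMod.val_natCast, Nat.mod_eq_of_lt (hlt l), Nat.mod_eq_of_lt (hlt l')]
      at this
  cases l <;> cases l' <;> simp only [posI, posK] at hI hK' <;>
    first
    | rfl
    | omega
    | (subst hI; subst hK'; rfl)
    | (subst hK'; rfl)
    | (obtain rfl := (show _ = _ from by assumption); rfl)
    | skip
  rename_i i1 h1 h1' i2 h2 h2'
  obtain rfl : i1 = i2 := by omega
  rfl

theorem lam_vec {m : ℕ} [NeZero e] (hm : 1 ≤ m) (hτ : τ ^ e = 1)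
    (l : LamIdx e (m + 1)) :
    (gLam (akT (e := e) (MulOpposite.op (oT e (m + 1) τ s) : OpA B e (m + 1))
      (fun j => MulOpposite.op (oS e (m + 1) s j)))
      (fun j => MulOpposite.op (oS e (m + 1) s j)) (m + 1) l).unop (vv B e (m + 1) (m + 1) 0)
      = pw τ (-(posK e (m + 1) l : ZMod e)) •
        vv B e (m + 1) (posI e (m + 1) l) (posK e (m + 1) l : ZMod e) := by
  set τ' : OpA B e (m + 1) := MulOpposite.op (oT e (m + 1) τ s) with hτ'
  set s' : ℕ → OpA B e (m + 1) := fun j => MulOpposite.op (oS e (m + 1) s j) with hs'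
  have hp : τ' ^ e = 1 := by rw [hτ', ← MulOpposite.op_pow, oT_pow hτ, MulOpposite.op_one]
  have hD : ∀ d i, i + d = m + 2 → 2 ≤ i →
      (gDesc s' (m + 1) i).unop (vv B e (m + 1) (m + 1) 0) = vv B e (m + 1) (i - 1) 0 := by
    intro d
    induction d with
    | zero =>
      intro i hi _
      rw [gDesc_empty s' (by omega), show i - 1 = m + 1 by omega]; rfl
    | succ d ih =>
      intro i hi h2
      rw [gDesc_bot s' (by omega), opA_mul, ih (i + 1) (by omega) (by omega)]
      obtain ⟨i, rfl⟩ : ∃ i', i = i' + 1 := ⟨i - 1, by omega⟩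
      simp only [Nat.add_sub_cancel, hs', MulOpposite.unop_op]
      exact oS_dn0 (by omega)
  have hA : ∀ (k : ZMod e) (hk : k ≠ 0) (d : ℕ), 2 + d ≤ m + 1 →
      (gAsc s' 3 (2 + d)).unop (vv B e (m + 1) 2 k) = vv B e (m + 1) (2 + d) k := by
    intro k hk d
    induction d with
    | zero => intro _; rw [gAsc_empty s' (by omega)]; rfl
    | succ d ih =>
      intro hd
      rw [← add_assoc, gAsc_top s' (by omega), opA_mul, ih (by omega)]
      exact oS_up hk (by omega) (by omega)
  have hT : ∀ k : ℕ, (akT (e := e) τ' s' (k : ZMod e)).unop (vv B e (m + 1) 2 0)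
      = pw τ (-(k : ZMod e)) • vv B e (m + 1) 1 k := by
    intro k
    rw [akT, opA_mul, opA_mul]
    have e1 : (pw τ' (-(k : ZMod e))).unop (vv B e (m + 1) 2 0)
        = pw τ (-(k : ZMod e)) • vv B e (m + 1) 2 0 := by
      rw [pw, pw, hτ', ← MulOpposite.op_pow, MulOpposite.unop_op, oT_pow_zero le_rfl (by omega)]
    have e2 : (s' 2).unop (vv B e (m + 1) 2 0) = vv B e (m + 1) 1 0 :=
      oS_dn0 (i := 1) (by omega)
    rw [e1, map_smul, map_smul, e2, pw_natCast hp, hτ', ← MulOpposite.op_pow, MulOpposite.unop_op,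
      oT_pow_one (by omega), zero_add]
  have hT0 : akT (e := e) τ' s' 0 = s' 2 := by
    rw [akT, neg_zero, pw_zero hp, one_mul, mul_one]
  have hD3 : (gDesc s' (m + 1) 3).unop (vv B e (m + 1) (m + 1) 0) = vv B e (m + 1) 2 0 :=
    hD (m - 1) 3 (by omega) (by omega)
  cases l with
  | one => simp [gLam, posI, posK, pw_zero hτ]
  | sdesc i' h3 hi =>
    simp only [gLam, posI, posK, Nat.cast_zero, neg_zero, pw_zero hτ, one_smul]
    exact hD (m + 2 - i') i' (by omega) (by omega)
  | st k hk =>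
    simp only [gLam, posI, posK]
    rw [opA_mul, hD3, hT]
  | stst k hk1 hk i' h2 hi =>
    have hk0 : (k : ZMod e) ≠ 0 := by
      intro h
      have := Nat.le_of_dvd (by omega) ((ZMod.natCast_eq_zero_iff k e).1 h)
      omega
    obtain ⟨d, rfl⟩ : ∃ d, i' = 2 + d := ⟨i' - 2, by omega⟩
    simp only [gLam, posI, posK]
    rw [opA_mul, opA_mul, opA_mul, hD3, hT, map_smul, map_smul, hT0]
    have : (s' 2).unop (vv B e (m + 1) 1 (k : ZMod e)) = vv B e (m + 1) 2 k :=
      oS_up (i := 1) hk0 le_rfl (by omega)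
    rw [this, hA _ hk0 _ hi]

theorem tower (e : ℕ) [NeZero e] (N : ℕ) : ∃ (B : Type) (_ : Ring B) (_ : Algebra R0 B) (τ : B)
    (s : ℕ → B), AK e (N + 1) τ s ∧
      LinearIndependent R0 (gNf (akT (e := e) τ s) s N) := by
  induction N with
  | zero =>
    refine ⟨R0, inferInstance, inferInstance, 1, 1, ⟨⟨?_, ?_, ?_⟩, ?_, ?_, ?_⟩, ?_⟩
    · intros; omega
    · intros; omega
    · intros; omega
    · simp
    · intros; omega
    · intros; omega
    · rw [Fintype.linearIndependent_iff]
      intro g hg i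
      have : ∀ p, gNf (akT (e := e) (1 : R0) 1) 1 0 p = 1 := by intro p; simp [gNf]
      simp only [this] at hg
      obtain rfl : i = default := Subsingleton.elim _ _
      simpa using hg
  | succ N ih =>
    obtain ⟨B, _, _, τ, s, h, hl⟩ := ih
    refine ⟨OpA B e (N + 1 + 1), inferInstance, inferInstance, _, _, ak_succ (by omega) h, ?_⟩
    set τ' : OpA B e (N + 1 + 1) := MulOpposite.op (oT e (N + 1 + 1) τ s) with hτ'
    set s' : ℕ → OpA B e (N + 1 + 1) := fun j => MulOpposite.op (oS e (N + 1 + 1) s j) with hs'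
    let ev : OpA B e (N + 1 + 1) →ₗ[R0] NM B e (N + 1 + 1) :=
      { toFun := fun x => x.unop (vv B e (N + 1 + 1) (N + 1 + 1) 0)
        map_add' := fun _ _ => rfl
        map_smul' := fun _ _ => rfl }
    apply LinearIndependent.of_comp ev
    have hτr : rowR B e (N + 1 + 1) τ' τ := oT_zero (by omega) le_rfl
    have hsr : ∀ j, j < N + 1 + 1 → rowR B e (N + 1 + 1) (s' j) (s j) := fun j hj =>
      oS_lt 0 le_rfl hj
    have hrow : ∀ q, rowR B e (N + 1 + 1) (gNf (akT (e := e) τ' s') s' N q)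
        (gNf (akT (e := e) τ s) s N q) := by
      intro q
      rcases Nat.eq_zero_or_pos N with rfl | hN
      · simpa [gNf] using rowR_one
      · have htr : ∀ k : ZMod e, rowR B e (N + 1 + 1) (akT τ' s' k) (akT τ s k) := fun k =>
          rowR_mul _ _ _ _ (rowR_mul _ _ _ _ (rowR_pow _ _ hτr _) (hsr 2 (by omega)))
            (rowR_pow _ _ hτr _)
        exact gNf_rel (rowR B e (N + 1 + 1)) rowR_one (fun x x' y y' => rowR_mul x x' y y')
          _ _ _ _ N htr (fun j _ hj => hsr j (by omega)) q
    have hsingle := Finsupp.linearIndependent_single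
      (ι := {i : ℕ // 1 ≤ i ∧ i ≤ N + 1 + 1} × ZMod e)
      (φ := fun _ => ∀ j : Fin N, LamIdx e (j.val + 2))
      (fun x q => gNf (akT (e := e) τ s) s N q * pw τ (-x.2)) (R := R0) (by
        intro x
        refine hl.map' (LinearMap.mulRight R0 (pw τ (-x.2))) (LinearMap.ker_eq_bot_of_injective ?_)
        intro y z hyz
        have hyz' : y * pw τ (-x.2) = z * pw τ (-x.2) := hyz
        have := congrArg (· * pw τ x.2) hyz'
        simpa only [mul_assoc, pw_neg h.pow, mul_one] using this)
    have hc := hsingle.comp (fun p : (∀ j : Fin (N + 1), LamIdx e (j.val + 2)) =>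
      (⟨(⟨posI e (N + 2) (p (Fin.last N)), posI_mem (by omega) _⟩,
        (posK e (N + 2) (p (Fin.last N)) : ZMod e)), fun j => p j.castSucc⟩ :
        Σ _ : {i : ℕ // 1 ≤ i ∧ i ≤ N + 1 + 1} × ZMod e, ∀ j : Fin N, LamIdx e (j.val + 2))) (by
      intro p p' hpp
      simp only [Sigma.mk.injEq, Prod.mk.injEq, Subtype.mk.injEq, heq_eq_eq] at hpp
      obtain ⟨⟨h1, h2⟩, h3⟩ := hpp
      have hlast := pos_inj (by omega) _ _ h1 h2
      funext j
      refine Fin.lastCases hlast (fun j => congrFun h3 j) j)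
    convert hc using 1
    funext p
    have hlam := lam_vec (s := s) (m := N + 1) (by omega) h.pow (p (Fin.last N))
    change (gNf (akT (e := e) τ' s') s' (N + 1) p).unop _ = _
    rw [gNf_succ, opA_mul, hrow, map_smul]
    erw [hlam]
    rw [smul_smul]
    simp [vv, posI_mem (show 2 ≤ N + 2 by omega) (p (Fin.last N))]

end Tower

section Spanning

variable {A : Type*} [Ring A] [Algebra R0 A] {e n : ℕ} {t : ZMod e → A} {s : ℕ → A}

theorem HK.tq' (h : HK e n t s) (x : A) (k : ZMod e) : x * t k * t k = aP • (x * t k) + x := by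
  rw [mul_assoc, h.tq, mul_add, mul_one, ← mul_assoc, ← Algebra.commutes, mul_assoc,
    Algebra.smul_def]

theorem Br.sq' {lo : ℕ} (h : Br lo n s) (x : A) {j : ℕ} (h1 : lo ≤ j) (h2 : j ≤ n) :
    x * s j * s j = aP • (x * s j) + x := by
  rw [mul_assoc, h.sq j h1 h2, mul_add, mul_one, ← mul_assoc, ← Algebra.commutes, mul_assoc,
    Algebra.smul_def]

theorem HK.dih (h : HK e n t s) (x : A) (k l : ZMod e) :
    x * t k * t l = x * t (k - 1) * t (l - 1) + aP • (x * t l) - aP • (x * t (k - 1)) := by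
  have hα := Algebra.commutes (A := A) aP
  set α := algebraMap R0 A aP with hαd
  have i1 : ∀ k, (t k - α) * t k = 1 := fun k => by rw [sub_mul, h.tq]; abel
  have i2 : ∀ k, t k * (t k - α) = 1 := fun k => by rw [mul_sub, h.tq, hα]; abel
  have e1 : (t k - α) * t l = t (k - 1) * (t (l - 1) - α) := by
    calc (t k - α) * t l = (t k - α) * t l * (t (l - 1) * (t (l - 1) - α)) := by rw [i2, mul_one]
      _ = (t k - α) * (t l * t (l - 1)) * (t (l - 1) - α) := by noncomm_ring
      _ = ((t k - α) * t k) * t (k - 1) * (t (l - 1) - α) := by rw [h.tt l k]; noncomm_ring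
      _ = _ := by rw [i1, one_mul]
  have e2 : t k * t l = t (k - 1) * t (l - 1) + α * t l - α * t (k - 1) := by
    rw [hα (t (k - 1))]
    rw [sub_mul, mul_sub] at e1
    rw [sub_eq_iff_eq_add.1 e1]
    abel
  rw [mul_assoc, e2, Algebra.smul_def, Algebra.smul_def, ← hαd]
  simp only [mul_add, mul_sub, ← mul_assoc, hα]

theorem HK.quad [NeZero e] (h : HK e n t s) (Q : Submodule R0 A) (D : A) (b : ZMod e)
    (h1 : ∀ k, D * t k ∈ Q) (h2 : ∀ k, D * t k * t b ∈ Q) (k l : ZMod e) :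
    D * t k * t l ∈ Q := by
  have : ∀ (r : ℕ) (k : ZMod e), D * t k * t (b + r) ∈ Q := by
    intro r
    induction r with
    | zero => intro k; simpa using h2 k
    | succ r ih =>
      intro k
      rw [h.dih]
      refine Q.sub_mem (Q.add_mem ?_ (Q.smul_mem _ (h1 _))) (Q.smul_mem _ (h1 _))
      have := ih (k - 1)
      rwa [show b + ((r + 1 : ℕ) : ZMod e) - 1 = b + r by push_cast; ring]
  obtain ⟨r, hr⟩ := ZMod.natCast_zmod_surjective (l - b)
  have := this r k
  rwa [hr, add_sub_cancel] at this

theorem HK.cubic [NeZero e] (h : HK e n t s) (Q : Submodule R0 A) (D : A)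
    (h1 : ∀ k, D * t k ∈ Q) (h2 : ∀ k l, D * t k * t l ∈ Q) (k i l : ZMod e) :
    D * t k * t i * t l ∈ Q := by
  have : ∀ (r : ℕ) (l : ZMod e), D * t k * t (k - r) * t l ∈ Q := by
    intro r
    induction r with
    | zero =>
      intro l
      rw [Nat.cast_zero, sub_zero, h.tq', add_mul, smul_mul_assoc]
      exact Q.add_mem (Q.smul_mem _ (h2 _ _)) (h1 l)
    | succ r ih =>
      intro l
      have := h.dih (D * t k) (k - r) (l + 1)
      rw [add_sub_cancel_right, show k - (r : ZMod e) - 1 = k - ((r + 1 : ℕ) : ZMod e) by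
        push_cast; ring] at this
      rw [show D * t k * t (k - ((r + 1 : ℕ) : ZMod e)) * t l = D * t k * t (k - r) * t (l + 1)
        - aP • (D * t k * t (l + 1)) + aP • (D * t k * t (k - ((r + 1 : ℕ) : ZMod e))) by
        rw [this]; abel]
      exact Q.add_mem (Q.sub_mem (ih _) (Q.smul_mem _ (h2 _ _))) (Q.smul_mem _ (h2 _ _))
  obtain ⟨r, hr⟩ := ZMod.natCast_zmod_surjective (k - i)
  have := this r l
  rwa [hr, sub_sub_cancel] at this

/-- Right multiplication of the listed expressions by `s_j`. -/
theorem HK.stage1 [NeZero e] (h : HK e n t s) {m : ℕ} (hm : 3 ≤ m) (hmn : m ≤ n)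
    (G : Submodule R0 A) (hL : ∀ l : LamIdx e m, gLam t s m l ∈ G)
    (ht : ∀ k, ∀ y ∈ G, t k * y ∈ G) (hs : ∀ j, 3 ≤ j → j < m → ∀ y ∈ G, s j * y ∈ G)
    (l : LamIdx e m) (j : ℕ) (h3 : 3 ≤ j) (hj : j ≤ m) : gLam t s m l * s j ∈ G := by
  have hD : ∀ i, 3 ≤ i → i ≤ m + 1 → gDesc s m i ∈ G := by
    intro i h3 hi
    rcases Nat.lt_or_ge m i with h' | h'
    · rw [gDesc_empty s h']; exact hL .one
    · exact hL (.sdesc i h3 h')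
  have hD4t : ∀ k, gDesc s m 4 * t k = t k * gDesc s m 4 := fun k =>
    (gDesc_comm s fun j h1 h2 => (h.st k j h1 (by omega)).symm).symm
  have hD3 : gDesc s m 3 = gDesc s m 4 * s 3 := gDesc_bot s hm
  cases l with
  | one =>
    rw [gLam, one_mul]
    rcases Nat.lt_or_ge j m with h' | h'
    · simpa using hs j h3 h' 1 (hL .one)
    · obtain rfl : j = m := by omega
      have := hD j h3 (by omega)
      rwa [gDesc_bot s le_rfl, gDesc_empty s (by omega), one_mul] at this
  | sdesc i hi3 hi =>
    rw [gLam]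
    rcases lt_trichotomy j i with hji | rfl | hji
    · rcases Nat.lt_or_ge (j + 1) i with h' | h'
      · rw [← gDesc_comm s (x := s j) fun l h1 h2 => h.toBr.cm j l h3 (by omega) (by omega)]
        exact hs j h3 (by omega) _ (hD i hi3 (by omega))
      · obtain rfl : i = j + 1 := by omega
        rw [← gDesc_bot s (by omega)]
        exact hD j h3 (by omega)
    · rw [gDesc_bot s hi, h.toBr.sq' _ h3 (by omega), ← gDesc_bot s hi]
      exact G.add_mem (G.smul_mem _ (hD j h3 (by omega))) (hD _ (by omega) (by omega))
    · rw [h.toBr.desc (by omega) hi3 hji hj hmn]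
      exact hs _ (by omega) (by omega) _ (hD i hi3 (by omega))
  | st k hk =>
    have hG := hL (.st k hk)
    rw [gLam] at *
    rcases Nat.eq_or_lt_of_le h3 with rfl | h4
    · have := ht k _ hG
      have e1 : gDesc s m 3 * t k * s 3 = t k * (gDesc s m 3 * t k) := by
        calc gDesc s m 3 * t k * s 3 = gDesc s m 4 * (s 3 * t k * s 3) := by
              rw [hD3]; noncomm_ring
          _ = (gDesc s m 4 * t k) * s 3 * t k := by rw [← h.tst (by omega)]; noncomm_ring
          _ = _ := by rw [hD4t, hD3]; noncomm_ring
      rwa [e1]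
    · have e1 : gDesc s m 3 * t k * s j = s (j - 1) * (gDesc s m 3 * t k) := by
        rw [mul_assoc, ← h.st k j h4 (by omega), ← mul_assoc,
          h.toBr.desc (by omega) le_rfl h4 hj hmn, mul_assoc]
      rw [e1]
      exact hs _ (by omega) (by omega) _ hG
  | stst k hk1 hk i h2 hi =>
    have hG := hL (.stst k hk1 hk i h2 hi)
    -- moving `s_j`, `j ≥ 4`, through `s_m … s_3 t_k t_0`
    have mv : ∀ l, 4 ≤ l → l ≤ m → ∀ y, gDesc s m 3 * t k * t 0 * (s l * y) =
        s (l - 1) * (gDesc s m 3 * t k * t 0 * y) := by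
      intro l h4 hl y
      have c0 := h.st 0 l h4 (by omega)
      have ck := h.st k l h4 (by omega)
      have cd := h.toBr.desc (m := m) (by omega) le_rfl (show 3 < l by omega) hl hmn
      calc gDesc s m 3 * t k * t 0 * (s l * y) = gDesc s m 3 * t k * (t 0 * s l) * y := by
            noncomm_ring
        _ = gDesc s m 3 * (t k * s l) * t 0 * y := by rw [← c0]; noncomm_ring
        _ = (gDesc s m 3 * s l) * t k * t 0 * y := by rw [← ck]; noncomm_ring
        _ = _ := by rw [cd]; noncomm_ring
    rw [gLam] at *
    rcases lt_trichotomy j i with hji | rfl | hji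
    · rw [mul_assoc, h.toBr.asc (by omega) le_rfl h3 hji (by omega), mv _ (by omega) (by omega)]
      exact hs _ (by omega) (by omega) _ hG
    · obtain ⟨j, rfl⟩ : ∃ j', j = j' + 1 := ⟨j - 1, by omega⟩
      have hG' := hL (.stst k hk1 hk j (by omega) (by omega))
      rw [gLam] at hG'
      rw [gAsc_top s h3, ← mul_assoc] at hG ⊢
      rw [h.toBr.sq' _ h3 (by omega)]
      exact G.add_mem (G.smul_mem _ hG) hG'
    · rcases Nat.lt_or_ge (i + 1) j with h' | h'
      · rw [mul_assoc, ← gAsc_comm s (x := s j)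
          fun l h1 h2 => (h.toBr.cm l j h1 (by omega) (by omega)).symm, mv _ (by omega) (by omega)]
        exact hs _ (by omega) (by omega) _ hG
      · obtain rfl : j = i + 1 := by omega
        rw [mul_assoc, ← gAsc_top s (by omega)]
        exact hL (.stst k hk1 hk (i + 1) (by omega) (by omega))

/-- Right multiplication by `t_l`. -/
theorem HK.stage2 [NeZero e] (h : HK e n t s) {m : ℕ} (hm : 3 ≤ m) (hmn : m ≤ n)
    (G : Submodule R0 A) (hL : ∀ l : LamIdx e m, gLam t s m l ∈ G)
    (ht : ∀ k, ∀ y ∈ G, t k * y ∈ G)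
    (hr : ∀ j, 3 ≤ j → j ≤ m → ∀ y ∈ G, y * s j ∈ G)
    (l : LamIdx e m) (b : ZMod e) : gLam t s m l * t b ∈ G := by
  have hD : ∀ i, 3 ≤ i → i ≤ m + 1 → gDesc s m i ∈ G := by
    intro i h3 hi
    rcases Nat.lt_or_ge m i with h' | h'
    · rw [gDesc_empty s h']; exact hL .one
    · exact hL (.sdesc i h3 h')
  have hDt : ∀ i, 4 ≤ i → ∀ k, gDesc s m i * t k = t k * gDesc s m i := fun i hi k =>
    (gDesc_comm s fun j h1 h2 => (h.st k j (by omega) (by omega)).symm).symm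
  have hD3 : gDesc s m 3 = gDesc s m 4 * s 3 := gDesc_bot s hm
  have q1 : ∀ k : ZMod e, gDesc s m 3 * t k ∈ G := by
    intro k
    have := hL (.st k.val k.val_lt)
    rwa [gLam, ZMod.natCast_zmod_val] at this
  have q2 : ∀ k : ZMod e, gDesc s m 3 * t k * t 0 ∈ G := by
    intro k
    by_cases hk : k = 0
    · subst hk
      rw [h.tq']
      exact G.add_mem (G.smul_mem _ (q1 0)) (hD 3 le_rfl (by omega))
    · have := hL (.stst k.val (by have := (ZMod.val_ne_zero k).2 hk; omega) k.val_lt 2 le_rfl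
        (by omega))
      rwa [gLam, ZMod.natCast_zmod_val, gAsc_empty s (by omega), mul_one] at this
  have q3 := h.quad G _ 0 q1 q2
  have q4 := h.cubic G _ q1 q3
  have sw : ∀ (j : ZMod e) (y : A), gDesc s m 3 * t j * s 3 * y = t j * (gDesc s m 3 * t j * y) := by
    intro j y
    calc gDesc s m 3 * t j * s 3 * y = gDesc s m 4 * (s 3 * t j * s 3) * y := by
          rw [hD3]; noncomm_ring
      _ = (gDesc s m 4 * t j) * s 3 * t j * y := by rw [← h.tst (by omega)]; noncomm_ring
      _ = _ := by rw [hDt 4 le_rfl, hD3]; noncomm_ring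
  have q5 : ∀ k l, gDesc s m 3 * t k * t l * s 3 * t b ∈ G := by
    let Q : Submodule R0 A := G.comap (LinearMap.mulRight R0 (s 3 * t b))
    have hQ : ∀ x, x ∈ Q ↔ x * s 3 * t b ∈ G := by
      intro x
      rw [mul_assoc]; rfl
    intro k l
    rw [← hQ]
    refine h.quad Q _ b ?_ ?_ k l
    · intro k
      rw [hQ, sw]
      exact ht _ _ (q3 _ _)
    · intro k
      rw [hQ]
      have : gDesc s m 3 * t k * t b * s 3 * t b = t k * (gDesc s m 3 * t k * t b * s 3) := by
        calc gDesc s m 3 * t k * t b * s 3 * t b = gDesc s m 3 * t k * (t b * s 3 * t b) := by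
              noncomm_ring
          _ = gDesc s m 3 * t k * s 3 * (t b * s 3) := by rw [h.tst (by omega)]; noncomm_ring
          _ = _ := by rw [sw]; noncomm_ring
      rw [this]
      exact ht _ _ (hr 3 le_rfl hm _ (q3 _ _))
  have hasc : ∀ d y, 3 + d ≤ m → y ∈ G → y * gAsc s 4 (3 + d) ∈ G := by
    intro d y
    induction d with
    | zero => intro _ hy; rwa [gAsc_empty s (by omega), mul_one]
    | succ d ih =>
      intro hd hy
      rw [← add_assoc, gAsc_top s (by omega), ← mul_assoc]
      exact hr _ (by omega) (by omega) _ (ih (by omega) hy)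
  cases l with
  | one => simpa [gLam] using ht b _ (hL .one)
  | sdesc i h3 hi =>
    rw [gLam]
    rcases Nat.eq_or_lt_of_le h3 with rfl | h4
    · exact q1 b
    · rw [hDt i h4]
      exact ht _ _ (hD i h3 (by omega))
  | st k hk => exact q3 _ _
  | stst k hk1 hk i h2 hi =>
    rw [gLam]
    rcases Nat.eq_or_lt_of_le h2 with rfl | h3
    · rw [gAsc_empty s (by omega), mul_one]
      exact q4 _ _ _
    · obtain ⟨d, rfl⟩ : ∃ d, i = 3 + d := ⟨i - 3, by omega⟩
      have := hasc d _ hi (q5 k 0)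
      rw [mul_assoc, gAsc_comm s (x := t b) fun j h1 h2 => (h.st b j h1 (by omega)).symm,
        ← mul_assoc] at this
      rwa [gAsc_bot s (by omega), ← mul_assoc]

/-- Right multiplication by `t_l` for `m = 2`. -/
theorem HK.stage0 [NeZero e] (h : HK e n t s)
    (G : Submodule R0 A) (hL : ∀ l : LamIdx e 2, gLam t s 2 l ∈ G)
    (l : LamIdx e 2) (b : ZMod e) : gLam t s 2 l * t b ∈ G := by
  have q0 : (1 : A) ∈ G := hL .one
  have hD3 : gDesc s 2 3 = 1 := gDesc_empty s (by omega)
  have q1 : ∀ k : ZMod e, 1 * t k ∈ G := by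
    intro k
    have := hL (.st k.val k.val_lt)
    rwa [gLam, ZMod.natCast_zmod_val, hD3] at this
  have q2 : ∀ k : ZMod e, 1 * t k * t 0 ∈ G := by
    intro k
    by_cases hk : k = 0
    · subst hk
      rw [h.tq']
      exact G.add_mem (G.smul_mem _ (q1 0)) q0
    · have := hL (.stst k.val (by have := (ZMod.val_ne_zero k).2 hk; omega) k.val_lt 2 le_rfl
        (by omega))
      rwa [gLam, ZMod.natCast_zmod_val, gAsc_empty s (by omega), mul_one, hD3] at this
  have q3 := h.quad G _ 0 q1 q2
  have q4 := h.cubic G _ q1 q3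
  cases l with
  | one => exact q1 b
  | sdesc i h3 hi => omega
  | st k hk => rw [gLam, hD3]; exact q3 _ _
  | stst k hk1 hk i h2 hi =>
    obtain rfl : i = 2 := by omega
    rw [gLam, hD3, gAsc_empty s (by omega), mul_one]
    exact q4 _ _ _

/-- The span of the normal forms is stable under right multiplication. -/
theorem HK.span_stable [NeZero e] (h : HK e n t s) (N : ℕ) (hN : N + 2 ≤ n) :
    (∀ b, ∀ y ∈ Submodule.span R0 (Set.range (gNf t s (N + 1))),
      y * t b ∈ Submodule.span R0 (Set.range (gNf t s (N + 1)))) ∧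
    (∀ j, 3 ≤ j → j ≤ N + 2 → ∀ y ∈ Submodule.span R0 (Set.range (gNf t s (N + 1))),
      y * s j ∈ Submodule.span R0 (Set.range (gNf t s (N + 1)))) := by
  -- general step
  have key : ∀ N : ℕ, ∃ G : Submodule R0 A,
      (∀ y, y ∈ G ↔ ∀ x ∈ Submodule.span R0 (Set.range (gNf t s N)),
        x * y ∈ Submodule.span R0 (Set.range (gNf t s (N + 1)))) ∧
      (∀ l, gLam t s (N + 2) l ∈ G) ∧
      (∀ z, (∀ l, gLam t s (N + 2) l * z ∈ G) →
        ∀ y ∈ Submodule.span R0 (Set.range (gNf t s (N + 1))),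
          y * z ∈ Submodule.span R0 (Set.range (gNf t s (N + 1)))) := by
    intro N
    let G : Submodule R0 A :=
      { carrier := {y | ∀ x ∈ Submodule.span R0 (Set.range (gNf t s N)),
          x * y ∈ Submodule.span R0 (Set.range (gNf t s (N + 1)))}
        add_mem' := fun {a b} ha hb x hx => by
          rw [mul_add]; exact Submodule.add_mem _ (ha x hx) (hb x hx)
        zero_mem' := fun x hx => by rw [mul_zero]; exact Submodule.zero_mem _
        smul_mem' := fun c y hy x hx => by
          rw [mul_smul_comm]; exact Submodule.smul_mem _ _ (hy x hx) }
    have hG : ∀ y, y ∈ G ↔ ∀ x ∈ Submodule.span R0 (Set.range (gNf t s N)),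
        x * y ∈ Submodule.span R0 (Set.range (gNf t s (N + 1))) := fun y => Iff.rfl
    refine ⟨G, hG, ?_, ?_⟩
    · intro l
      rw [hG]
      intro x hx
      induction hx using Submodule.span_induction with
      | mem x hx =>
        obtain ⟨q, rfl⟩ := hx
        apply Submodule.subset_span
        refine ⟨Fin.snoc (α := fun j : Fin (N + 1) => LamIdx e (j.val + 2)) q l, ?_⟩
        rw [gNf_succ]
        simp
      | zero => simp
      | add x y _ _ hx hy => rw [add_mul]; exact Submodule.add_mem _ hx hy
      | smul c x _ hx => rw [smul_mul_assoc]; exact Submodule.smul_mem _ _ hx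
    · intro z hz y hy
      induction hy using Submodule.span_induction with
      | mem x hx =>
        obtain ⟨p, rfl⟩ := hx
        rw [gNf_succ, mul_assoc]
        exact (hG _).1 (hz _) _ (Submodule.subset_span ⟨_, rfl⟩)
      | zero => simp
      | add x y _ _ hx hy => rw [add_mul]; exact Submodule.add_mem _ hx hy
      | smul c x _ hx => rw [smul_mul_assoc]; exact Submodule.smul_mem _ _ hx
  induction N with
  | zero =>
    obtain ⟨G, hG, hL, hY⟩ := key 0
    exact ⟨fun b => hY _ fun l => h.stage0 G hL l b, fun j h3 hj => by omega⟩
  | succ N ih =>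
    obtain ⟨iht, ihs⟩ := ih (by omega)
    obtain ⟨G, hG, hL, hY⟩ := key (N + 1)
    have ht : ∀ k, ∀ y ∈ G, t k * y ∈ G := by
      intro k y hy
      rw [hG] at *
      intro x hx
      rw [← mul_assoc]
      exact hy _ (iht k x hx)
    have hs : ∀ j, 3 ≤ j → j < N + 1 + 2 → ∀ y ∈ G, s j * y ∈ G := by
      intro j h3 hj y hy
      rw [hG] at *
      intro x hx
      rw [← mul_assoc]
      exact hy _ (ihs j h3 (by omega) x hx)
    have hYs := fun j h3 hj => hY (s j) fun l =>
      h.stage1 (by omega) hN G hL ht hs l j h3 hj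
    have hr : ∀ j, 3 ≤ j → j ≤ N + 1 + 2 → ∀ y ∈ G, y * s j ∈ G := by
      intro j h3 hj y hy
      rw [hG] at *
      intro x hx
      rw [← mul_assoc]
      exact hYs j h3 hj _ (hy x hx)
    exact ⟨fun b => hY _ fun l => h.stage2 (by omega) hN G hL ht hr l b, hYs⟩

end Spanning

section Final

/-- The defining relations hold in `H(e,e,n)`. -/
theorem hecke_hk (e n : ℕ) : HK e n (tH e n) (sH e n) where
  toBr := by
    refine ⟨?_, ?_, ?_⟩
    · intro j h3 hj
      have := RingQuot.mkAlgHom_rel R0 (HRel.sq (e := e) j h3 hj)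
      simpa [sH, h3, hj] using this
    · intro i h3 hi
      have h3' : 3 ≤ i + 1 := by omega
      have hi' : i ≤ n := by omega
      have := RingQuot.mkAlgHom_rel R0 (HRel.braid (e := e) i h3 h3' hi' hi)
      simp only [sH, dif_pos (And.intro h3 hi'), dif_pos (And.intro h3' hi)]
      simpa using this
    · intro i j h3 hij hj
      have h3' : 3 ≤ j := by omega
      have hi' : i ≤ n := by omega
      have := RingQuot.mkAlgHom_rel R0 (HRel.comm (e := e) i j h3 hi' h3' hj (Or.inl hij))
      simp only [sH, dif_pos (And.intro h3 hi'), dif_pos (And.intro h3' hj)]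
      simpa using this
  tt := by
    intro i j
    simpa [tH] using RingQuot.mkAlgHom_rel R0 (HRel.tt (n := n) i j)
  tst := by
    intro h3 i
    simpa [tH, sH, h3] using RingQuot.mkAlgHom_rel R0 (HRel.tst (n := n) i h3)
  st := by
    intro i j h4 hj
    have h3 : 3 ≤ j := by omega
    simpa [tH, sH, h3, hj] using RingQuot.mkAlgHom_rel R0 (HRel.st (n := n) i j h3 h4 hj)
  tq := by
    intro i
    simpa [tH] using RingQuot.mkAlgHom_rel R0 (HRel.tq (n := n) i)

/-- Universal property. -/
theorem hecke_lift {e n : ℕ} {A : Type} [Ring A] [Algebra R0 A] {t : ZMod e → A} {s : ℕ → A}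
    (h : HK e n t s) : ∃ φ : Hecke e n →ₐ[R0] A, (∀ k, φ (tH e n k) = t k) ∧
      ∀ j, 3 ≤ j → j ≤ n → φ (sH e n j) = s j := by
  let f : HGen e n → A := fun g => match g with
    | .t i => t i
    | .s j _ _ => s j
  have ft : ∀ i, f (.t i) = t i := fun _ => rfl
  have fs : ∀ j h1 h2, f (.s j h1 h2) = s j := fun _ _ _ => rfl
  have hrel : ∀ ⦃x y : FA e n⦄, HRel e n x y → FreeAlgebra.lift R0 f x = FreeAlgebra.lift R0 f y := by
    intro x y hxy
    cases hxy <;>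
      simp only [map_mul, map_add, map_one, FreeAlgebra.lift_ι_apply, ft, fs, AlgHom.commutes]
    · exact h.tt _ _
    · rename_i h3; exact h.tst h3 _
    · rename_i h4 hn; exact h.st _ _ h4 hn
    · rename_i i h3 h3' hn' hn; exact h.toBr.br i h3 hn
    · rename_i i j h3i hni h3j hnj hij
      rcases hij with hij | hij
      · exact h.toBr.cm i j h3i hij hnj
      · exact (h.toBr.cm j i h3j hij hni).symm
    · exact h.tq _
    · rename_i j h3 hn; exact h.toBr.sq j h3 hn
  refine ⟨RingQuot.liftAlgHom R0 ⟨FreeAlgebra.lift R0 f, hrel⟩, ?_, ?_⟩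
  · intro k
    rw [tH, RingQuot.liftAlgHom_mkAlgHom_apply, FreeAlgebra.lift_ι_apply]
  · intro j h3 hj
    rw [sH, dif_pos ⟨h3, hj⟩, RingQuot.liftAlgHom_mkAlgHom_apply, FreeAlgebra.lift_ι_apply]

theorem nfH_eq (e n : ℕ) : nfH e n = gNf (tH e n) (sH e n) (n - 1) := by
  funext p
  unfold nfH gNf
  congr 1

theorem nfH_linInd (e n : ℕ) (he : 1 ≤ e) (hn : 2 ≤ n) : LinearIndependent R0 (nfH e n) := by
  have : NeZero e := ⟨by omega⟩
  obtain ⟨B, _, _, τ, s, h, hl⟩ := tower e (n - 1)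
  rw [show n - 1 + 1 = n by omega] at h
  obtain ⟨φ, hφt, hφs⟩ := hecke_lift (h.hk hn)
  apply LinearIndependent.of_comp φ.toLinearMap
  have hcomp : (φ.toLinearMap ∘ nfH e n) = gNf (akT (e := e) τ s) s (n - 1) := by
    funext p
    rw [nfH_eq]
    exact gNf_rel (fun x y => φ x = y) (map_one φ)
      (fun x x' y y' h1 h2 => by rw [map_mul, h1, h2]) _ _ _ _ (n - 1) hφt
      (fun j h3 hj => hφs j h3 (by omega)) p
  rw [hcomp]
  exact hl

theorem nfH_span (e n : ℕ) (he : 1 ≤ e) (hn : 2 ≤ n) :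
    Submodule.span R0 (Set.range (nfH e n)) = ⊤ := by
  have : NeZero e := ⟨by omega⟩
  obtain ⟨N, rfl⟩ : ∃ N, n = N + 2 := ⟨n - 2, by omega⟩
  have hk := hecke_hk e (N + 2)
  obtain ⟨ht, hs⟩ := hk.span_stable N le_rfl
  rw [nfH_eq]
  change Submodule.span R0 (Set.range (gNf (tH e (N + 2)) (sH e (N + 2)) (N + 1))) = ⊤
  set Y := Submodule.span R0 (Set.range (gNf (tH e (N + 2)) (sH e (N + 2)) (N + 1))) with hYd
  have h1 : (1 : Hecke e (N + 2)) ∈ Y := by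
    apply Submodule.subset_span
    refine ⟨fun j => .one, ?_⟩
    simp [gNf, gLam]
  have hall : ∀ x : FA e (N + 2), ∀ y ∈ Y, y * RingQuot.mkAlgHom R0 (HRel e (N + 2)) x ∈ Y := by
    intro x
    induction x using FreeAlgebra.induction with
    | grade0 r =>
      intro y hy
      rw [AlgHom.commutes, ← Algebra.commutes, ← Algebra.smul_def]
      exact Y.smul_mem _ hy
    | grade1 g =>
      intro y hy
      cases g with
      | t i => exact ht i y hy
      | s j h3 hj =>
        have := hs j h3 hj y hy
        rwa [sH, dif_pos ⟨h3, hj⟩] at this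
    | mul a b ha hb =>
      intro y hy
      rw [map_mul, ← mul_assoc]
      exact hb _ (ha _ hy)
    | add a b ha hb =>
      intro y hy
      rw [map_add, mul_add]
      exact Y.add_mem (ha _ hy) (hb _ hy)
  rw [eq_top_iff]
  intro x _
  obtain ⟨x, rfl⟩ := RingQuot.mkAlgHom_surjective R0 (HRel e (N + 2)) x
  simpa using hall x 1 h1

end Final

/-- The products `a₂ ⋯ aₙ`, with `a_i` ranging over the listed expressions of `Λ_i`,
are pairwise distinct and form an `R₀`-basis of `H(e,e,n)`. -/
theorem Lambda_is_basis_of_Heen (e n : ℕ) (he : 1 ≤ e) (hn : 2 ≤ n)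
    (hex : ¬(n = 2 ∧ Even e)) :
    Function.Injective (nfH e n) ∧
    LinearIndependent R0 (nfH e n) ∧
    Submodule.span R0 (Set.range (nfH e n)) = ⊤ := by
  have hl := nfH_linInd e n he hn
  exact ⟨hl.injective, hl, nfH_span e n he hn⟩
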